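/- arXiv:1811.04872 — 2 statements merged into one kernel-verified Lean document; each statement's English description precedes it below -/
import Mathlib

section
/- Consider the instance where G is the path (v_1, v_2, …, v_{11}) and there are three agents a_1, a_2, b with binary additive valuations: each of a_1, a_2 approves all eleven items, and b approves exactly the items v_4, v_5. Then no connected allocation of this instance is both Pareto-optimal and EF1. -/
open Finset

/-- A finite set of items is *connected* in the item graph `G` if the induced
subgraph is preconnected (the empty set counts as connected). -/
def ConnSet {V : Type*} (G : SimpleGraph V) (X : Finset V) : Prop :=
  (G.induce (X : Set V)).Preconnected

/-- `π` is a connected allocation of the items in `R` among the agents in `N`. -/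
def IsConnAllocOn {V N : Type*} [DecidableEq V] (G : SimpleGraph V)
    (R : Finset V) (π : N → Finset V) : Prop :=
  (∀ i, π i ⊆ R) ∧ (∀ i, ConnSet G (π i)) ∧
    (∀ i j, i ≠ j → Disjoint (π i) (π j)) ∧ (∀ v ∈ R, ∃ i, v ∈ π i)

/-- `π` is a connected allocation of all items among the agents in `N`. -/
def IsConnAlloc {V N : Type*} [Fintype V] [DecidableEq V] (G : SimpleGraph V)
    (π : N → Finset V) : Prop :=
  IsConnAllocOn G Finset.univ π

/-- `π'` is a Pareto-improvement of `π`. -/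
def ParetoImproves {V N : Type*} (u : N → Finset V → ℝ)
    (π' π : N → Finset V) : Prop :=
  (∀ i, u i (π i) ≤ u i (π' i)) ∧ ∃ i, u i (π i) < u i (π' i)

/-- `π` is Pareto-optimal: no connected allocation Pareto-improves it. -/
def ParetoOptimal {V N : Type*} [Fintype V] [DecidableEq V] (G : SimpleGraph V)
    (u : N → Finset V → ℝ) (π : N → Finset V) : Prop :=
  ∀ π', IsConnAlloc G π' → ¬ ParetoImproves u π' π

/-- `π` satisfies EF1: any envy can be removed by deleting a single item
(keeping the envied bundle connected). -/
def EF1 {V N : Type*} [Fintype V] [DecidableEq V] (G : SimpleGraph V)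
    (u : N → Finset V → ℝ) (π : N → Finset V) : Prop :=
  ∀ i j, u i (π j) ≤ u i (π i) ∨
    ∃ v ∈ π j, ConnSet G ((π j).erase v) ∧ u i ((π j).erase v) ≤ u i (π i)

/-- The maximin fair share of an agent with valuation `u`, when the items are
divided into `|N|` connected bundles. -/
noncomputable def mmsVal {V : Type*} (N : Type*) [Fintype V] [DecidableEq V]
    (G : SimpleGraph V) (u : Finset V → ℝ) : ℝ :=
  sSup {x : ℝ | ∃ P : N → Finset V, IsConnAlloc G P ∧
    x = sInf (Set.range fun j => u (P j))}

/-- `π` is an MMS allocation: every agent gets at least her maximin fair share. -/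
def IsMMS {V N : Type*} [Fintype V] [DecidableEq V] (G : SimpleGraph V)
    (u : N → Finset V → ℝ) (π : N → Finset V) : Prop :=
  ∀ i, mmsVal N G (u i) ≤ u i (π i)

lemma conn_side {X : Finset (Fin 11)} (h : ConnSet (SimpleGraph.pathGraph 11) X)
    {c : Fin 11} (hc : c ∉ X) : X ⊆ Finset.Iio c ∨ X ⊆ Finset.Ioi c := by
  have key : ∀ (x y : (X : Set (Fin 11)))
      (_ : ((SimpleGraph.pathGraph 11).induce (X : Set (Fin 11))).Walk x y),
      x.1 < c → y.1 < c := by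
    intro x y p
    induction p with
    | nil => exact id
    | @cons a b d hab p ih =>
      intro ha
      apply ih
      have h1 : (SimpleGraph.pathGraph 11).Adj a.1 b.1 := hab
      rw [SimpleGraph.pathGraph_adj] at h1
      have h2 : b.1 ≠ c := fun e => hc (e ▸ b.2)
      omega
  by_cases hx : ∃ x ∈ X, x < c
  · obtain ⟨x, hx, hxc⟩ := hx
    left
    intro y hy
    obtain ⟨p⟩ := h ⟨x, hx⟩ ⟨y, hy⟩
    exact Finset.mem_Iio.2 (key _ _ p hxc)
  · right
    intro y hy
    push Not at hx
    rw [Finset.mem_Ioi]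
    exact lt_of_le_of_ne (hx y hy) (fun e => hc (e ▸ hy))

lemma conn_Icc (a b : Fin 11) : ConnSet (SimpleGraph.pathGraph 11) (Finset.Icc a b) := by
  have key : ∀ (k : ℕ) (x : ((Finset.Icc a b : Finset (Fin 11)) : Set (Fin 11)))
      (y : ((Finset.Icc a b : Finset (Fin 11)) : Set (Fin 11))), y.1.val = a.val → 
      x.1.val = a.val + k →
      ((SimpleGraph.pathGraph 11).induce ((Finset.Icc a b : Finset (Fin 11)) : Set (Fin 11))).Reachable y x := by
    intro k
    induction k with
    | zero =>
      intro x y hy hx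
      have : y = x := Subtype.ext (Fin.ext (by omega))
      rw [this]
    | succ k ih =>
      intro x y hy hx
      have hx2 := x.2
      simp only [Finset.coe_Icc, Set.mem_Icc] at hx2
      let z : Fin 11 := ⟨a.val + k, by omega⟩
      have hz : z ∈ ((Finset.Icc a b : Finset (Fin 11)) : Set (Fin 11)) := by
        simp only [Finset.coe_Icc, Set.mem_Icc, Fin.le_def, z]
        have := hx2.2
        rw [Fin.le_def] at this
        omega
      refine (ih ⟨z, hz⟩ y hy rfl).trans (SimpleGraph.Adj.reachable ?_)
      change (SimpleGraph.pathGraph 11).Adj z x.1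
      rw [SimpleGraph.pathGraph_adj]
      left
      simp only [z]
      omega
  intro x y
  have hx2 := x.2
  have hy2 := y.2
  simp only [Finset.coe_Icc, Set.mem_Icc, Fin.le_def] at hx2 hy2
  have ha : a ∈ ((Finset.Icc a b : Finset (Fin 11)) : Set (Fin 11)) := by
    simp only [Finset.coe_Icc, Set.mem_Icc, Fin.le_def]
    omega
  exact (key (x.1.val - a.val) x ⟨a, ha⟩ rfl (by omega)).symm.trans
    (key (y.1.val - a.val) y ⟨a, ha⟩ rfl (by omega))

/-- the allocation with agent `t` on the left, `b` in the middle, the other agent on the right -/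
def mkAlloc (t : Fin 2) (L M R : Finset (Fin 11)) : (Fin 2 ⊕ Unit) → Finset (Fin 11)
  | Sum.inl s => if s = t then L else R
  | Sum.inr _ => M

lemma mkAlloc_conn (t : Fin 2) {L M R : Finset (Fin 11)}
    (hL : ConnSet (SimpleGraph.pathGraph 11) L) (hM : ConnSet (SimpleGraph.pathGraph 11) M)
    (hR : ConnSet (SimpleGraph.pathGraph 11) R)
    (h1 : Disjoint L M) (h2 : Disjoint L R) (h3 : Disjoint M R) (h4 : L ∪ M ∪ R = univ) :
    IsConnAlloc (SimpleGraph.pathGraph 11) (mkAlloc t L M R) := by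
  refine ⟨fun i => Finset.subset_univ _, ?_, ?_, ?_⟩
  · rintro (s | s)
    · simp only [mkAlloc]; split_ifs <;> assumption
    · exact hM
  · rintro (s | s) (s' | s') hne
    · simp only [mkAlloc]
      split_ifs with e e'
      · exact absurd (by rw [e, e']) hne
      · exact h2
      · exact h2.symm
      · exact absurd (by congr 1; omega) hne
    · simp only [mkAlloc]
      split_ifs
      · exact h1
      · exact h3.symm
    · simp only [mkAlloc]
      split_ifs
      · exact h1.symm
      · exact h3
    · exact absurd rfl hne
  · intro v hv
    rw [← h4] at hv
    simp only [Finset.mem_union] at hv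
    obtain (hv | hv) | hv := hv
    · exact ⟨Sum.inl t, by simpa [mkAlloc] using hv⟩
    · exact ⟨Sum.inr (), hv⟩
    · refine ⟨Sum.inl (1 - t), ?_⟩
      have : (1 - t : Fin 2) ≠ t := by revert t; decide
      simpa [mkAlloc, this] using hv

/-- On the path `(v_1,…,v_11)` (encoded as `Fin 11`), with agents
`a_1,a_2` (`Sum.inl`) approving all items and agent `b` (`Sum.inr`) approving
`v_4,v_5`, no connected allocation is both Pareto-optimal and EF1. -/
theorem stmt9
    (A : (Fin 2 ⊕ Unit) → Finset (Fin 11))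
    (hA1 : ∀ t, A (Sum.inl t) = (Finset.univ : Finset (Fin 11)))
    (hA2 : A (Sum.inr ()) = ({3, 4} : Finset (Fin 11)))
    (u : (Fin 2 ⊕ Unit) → Finset (Fin 11) → ℝ)
    (hu : ∀ i X, u i X = ((X ∩ A i).card : ℝ))
    (π : (Fin 2 ⊕ Unit) → Finset (Fin 11))
    (hπ : IsConnAlloc (SimpleGraph.pathGraph 11) π) :
    ¬ (ParetoOptimal (SimpleGraph.pathGraph 11) u π ∧
       EF1 (SimpleGraph.pathGraph 11) u π) := by
  rintro ⟨hPO, hEF⟩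
  obtain ⟨-, hconn, hdisj, hcov⟩ := hπ
  have hua : ∀ t X, u (Sum.inl t) X = (X.card : ℝ) := by
    intro t X; rw [hu, hA1, Finset.inter_univ]
  have hub : ∀ X, u (Sum.inr ()) X = ((X ∩ {3, 4}).card : ℝ) := by
    intro X; rw [hu, hA2]
  -- the two agents approving everything have almost equal bundles
  have hdiff : ∀ s t, (π (Sum.inl t)).card ≤ (π (Sum.inl s)).card + 1 := by
    intro s t
    rcases hEF (Sum.inl s) (Sum.inl t) with h | ⟨v, hv, -, h⟩
    · rw [hua, hua, Nat.cast_le] at h; omega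
    · rw [hua, hua, Nat.cast_le, Finset.card_erase_of_mem hv] at h; omega
  -- Pareto-improvements
  have improve : ∀ (t : Fin 2) (L M R : Finset (Fin 11)),
      IsConnAlloc (SimpleGraph.pathGraph 11) (mkAlloc t L M R) →
      (π (Sum.inr ()) ∩ {3, 4}).card ≤ (M ∩ {3, 4}).card →
      (π (Sum.inl t)).card ≤ L.card → (π (Sum.inl (1 - t))).card < R.card → False := by
    intro t L M R hc hb hl hr
    have hne : (1 - t : Fin 2) ≠ t := (by decide : ∀ t : Fin 2, (1 - t : Fin 2) ≠ t) t
    refine hPO _ hc ⟨?_, Sum.inl (1 - t), ?_⟩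
    · rintro (s | s)
      · rw [hua, hua, Nat.cast_le]
        by_cases e : s = t
        · subst e; simpa [mkAlloc] using hl
        · have : s = 1 - t := (by decide : ∀ s t : Fin 2, s ≠ t → s = 1 - t) s t e
          subst this; simpa [mkAlloc, hne] using hr.le
      · rw [hub, hub, Nat.cast_le]; exact hb
    · rw [hua, hua, Nat.cast_lt]; simpa [mkAlloc, hne] using hr
  have imp1 : ∀ t, (π (Sum.inl t)).card ≤ 3 → False := by
    intro t ht
    refine improve t (Icc 0 2) (Icc 3 4) (Icc 5 10)
      (mkAlloc_conn t (conn_Icc _ _) (conn_Icc _ _) (conn_Icc _ _)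
        (by decide) (by decide) (by decide) (by decide)) ?_ ?_ ?_
    · exact (Finset.card_le_card Finset.inter_subset_right).trans (by decide)
    · exact ht.trans (by decide)
    · have := hdiff t (1 - t)
      have h6 : (Icc (5 : Fin 11) 10).card = 6 := by decide
      omega
  have imp2 : ∀ t, (π (Sum.inr ()) ∩ {3, 4}).card ≤ 1 → (π (Sum.inl t)).card ≤ 4 → False := by
    intro t hk ht
    refine improve t (Icc 0 3) (Icc 4 4) (Icc 5 10)
      (mkAlloc_conn t (conn_Icc _ _) (conn_Icc _ _) (conn_Icc _ _)
        (by decide) (by decide) (by decide) (by decide)) ?_ ?_ ?_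
    · exact hk.trans (by decide)
    · exact ht.trans (by decide)
    · have := hdiff t (1 - t)
      have h6 : (Icc (5 : Fin 11) 10).card = 6 := by decide
      omega
  have d01 : Disjoint (π (Sum.inl 0)) (π (Sum.inl 1)) := hdisj _ _ (by decide)
  have notin : ∀ c t, c ∈ π (Sum.inr ()) → c ∉ π (Sum.inl t) := by
    intro c t hc hcb
    exact Finset.disjoint_left.1 (hdisj (Sum.inr ()) (Sum.inl t) (by simp)) hc hcb
  -- if both agents are to the right of `v_4` or `v_5`, someone has at most 3 items
  have right : ∀ c : Fin 11, 3 ≤ c → π (Sum.inl 0) ⊆ Ioi c → π (Sum.inl 1) ⊆ Ioi c → False := by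
    intro c hc h0 h1
    have h : (π (Sum.inl 0) ∪ π (Sum.inl 1)).card ≤ (Ioi (3 : Fin 11)).card :=
      Finset.card_le_card
        ((Finset.union_subset h0 h1).trans (Finset.Ioi_subset_Ioi hc))
    rw [Finset.card_union_of_disjoint d01] at h
    have h7 : (Ioi (3 : Fin 11)).card = 7 := by decide
    by_cases h3 : (π (Sum.inl 0)).card ≤ 3
    · exact imp1 0 h3
    · exact imp1 1 (by omega)
  have left3 : ∀ t, π (Sum.inl t) ⊆ Iio 3 → False := by
    intro t h
    exact imp1 t ((Finset.card_le_card h).trans (by decide))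
  by_cases m3 : (3 : Fin 11) ∈ π (Sum.inr ())
  · rcases conn_side (hconn _) (notin 3 0 m3) with h0 | h0
    · exact left3 0 h0
    · rcases conn_side (hconn _) (notin 3 1 m3) with h1 | h1
      · exact left3 1 h1
      · exact right 3 le_rfl h0 h1
  · have hk : (π (Sum.inr ()) ∩ {3, 4}).card ≤ 1 := by
      have : π (Sum.inr ()) ∩ {3, 4} ⊆ {4} := by
        intro x hx
        simp only [Finset.mem_inter, Finset.mem_insert, Finset.mem_singleton] at hx ⊢
        rcases hx with ⟨hx, rfl | rfl⟩
        · exact absurd hx m3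
        · rfl
      exact (Finset.card_le_card this).trans (by decide)
    have left4 : ∀ t, π (Sum.inl t) ⊆ Iio 4 → False := by
      intro t h
      exact imp2 t hk ((Finset.card_le_card h).trans (by decide))
    by_cases m4 : (4 : Fin 11) ∈ π (Sum.inr ())
    · rcases conn_side (hconn _) (notin 4 0 m4) with h0 | h0
      · exact left4 0 h0
      · rcases conn_side (hconn _) (notin 4 1 m4) with h1 | h1
        · exact left4 1 h1
        · exact right 4 (by decide) h0 h1
    · -- `b` gets nothing of value
      have hz : π (Sum.inr ()) ∩ {3, 4} = ∅ := by
        ext x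
        simp only [Finset.mem_inter, Finset.mem_insert, Finset.mem_singleton,
          Finset.notMem_empty, iff_false]
        rintro ⟨hx, rfl | rfl⟩
        · exact m3 hx
        · exact m4 hx
      obtain ⟨j | j, hj⟩ := hcov 3 (Finset.mem_univ _)
      · by_cases h4 : (4 : Fin 11) ∈ π (Sum.inl j)
        · rcases hEF (Sum.inr ()) (Sum.inl j) with h | ⟨v, hv, -, h⟩
          · rw [hub, hub, Nat.cast_le, hz, Finset.card_empty, Nat.le_zero,
              Finset.card_eq_zero] at h
            have : (3 : Fin 11) ∈ π (Sum.inl j) ∩ {3, 4} := by simp [hj]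
            rw [h] at this
            simp at this
          · rw [hub, hub, Nat.cast_le, hz, Finset.card_empty, Nat.le_zero,
              Finset.card_eq_zero] at h
            by_cases e : v = 3
            · have : (4 : Fin 11) ∈ (π (Sum.inl j)).erase v ∩ {3, 4} := by
                subst e; simp [h4]
              rw [h] at this
              simp at this
            · have : (3 : Fin 11) ∈ (π (Sum.inl j)).erase v ∩ {3, 4} := by
                simp [hj, Ne.symm e]
              rw [h] at this
              simp at this
        · rcases conn_side (hconn _) h4 with h | h
          · exact left4 j h
          · exact absurd (Finset.mem_Ioi.1 (h hj)) (by decide)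
      · exact m3 hj
end

section
/- Let (X,S) be an X3C instance. Construct the following allocation instance on a path: for each S ∈ S, a path P_S = (v_{S,1}, v_{S,2}, v_{S,3}); for each k ∈ {1,…,s−r}, a path P_{d_k} = (v^k_1,…,v^k_{10}) of ten vertices; for each x ∈ X, a path P_x = (v^x_1,…,v^x_{11}) of eleven vertices; and for each h ∈ {1,…,2s+2r}, a path P_{z_h} of two vertices. The graph G is the single path obtained by concatenating, in order, P_{S_1}, P_{z_1}, P_{S_2}, P_{z_2}, …, P_{S_s}, P_{z_s}, P_{x_1}, P_{z_{s+1}}, …, P_{x_{3r}}, P_{z_{s+3r}}, P_{d_1}, P_{z_{s+3r+1}}, …, P_{d_{s−r}}, P_{z_{2s+2r}}. The agents all have binary additive valuations: for each x ∈ X, agent i_x approves exactly the items v_{S,j} with S^j = x together with v^x_4 and v^x_5; for each k ∈ {1,…,s−r}, agent d_k approves exactly all items v_{S,j} (S ∈ S, j ∈ {1,2,3}) together with the vertices of P_{d_k} other than v^k_5, v^k_6; for each k, agents a^1_k and a^2_k each approve exactly the vertices of P_{d_k} other than v^k_5, v^k_6, and agent b_k approves exactly v^k_5, v^k_6; for each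 x ∈ X, agents a^1_x and a^2_x each approve exactly all eleven vertices of P_x; for each h, agent z_h approves exactly the two vertices of P_{z_h}. Then this instance admits a connected allocation that is both Pareto-optimal and EF1 if and only if (X,S) has an exact cover. -/
open Finset

/-- Agents of the X3C path instance for PO & EF1: in order, the agents `i_x`,
the agents `d_k`, the agents `a¹_x, a²_x`, the agents `a¹_k, a²_k`, the agents
`b_k`, and the dummy agents `z_h` (indexed by the block after which their
2-path sits: after `P_{S_k}`, after `P_{x}`, or after `P_{d_k}`). -/
abbrev X3CEF1Agents (r s : ℕ) :=
  Fin (3 * r) ⊕ Fin (s - r) ⊕ (Fin (3 * r) × Fin 2) ⊕ (Fin (s - r) × Fin 2) ⊕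
    Fin (s - r) ⊕ (Fin s ⊕ Fin (3 * r) ⊕ Fin (s - r))

section PathPart

/-- Order-convexity of a set of positions on the path. -/
def Iv {n : ℕ} (X : Finset (Fin n)) : Prop :=
  ∀ a ∈ X, ∀ b ∈ X, ∀ c, a ≤ c → c ≤ b → c ∈ X

/-- The interval `[a,b)` of positions. -/
def ivl (n a b : ℕ) : Finset (Fin n) :=
  Finset.univ.filter (fun v => a ≤ v.val ∧ v.val < b)

lemma mem_ivl {n a b : ℕ} {v : Fin n} : v ∈ ivl n a b ↔ a ≤ v.val ∧ v.val < b := by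
  simp [ivl]

lemma iv_ivl (n a b : ℕ) : Iv (ivl n a b) := by
  intro x hx y hy c h1 h2
  rw [mem_ivl] at *
  rw [Fin.le_def] at *
  omega

lemma card_ivl_le (n a b : ℕ) : (ivl n a b).card ≤ b - a := by
  rw [← Nat.card_Ico a b]
  apply Finset.card_le_card_of_injOn (fun v => v.val)
  · intro v hv
    have := mem_ivl.1 hv
    simpa using this
  · intro v _ w _ h
    exact Fin.ext h

lemma card_ivl {n a b : ℕ} (hb : b ≤ n) : (ivl n a b).card = b - a := by
  apply le_antisymm (card_ivl_le n a b)
  rw [← Nat.card_Ico a b]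
  have : Finset.Ico a b ⊆ (ivl n a b).image (fun v => v.val) := by
    intro x hx
    rw [Finset.mem_Ico] at hx
    rw [Finset.mem_image]
    exact ⟨⟨x, by omega⟩, mem_ivl.2 hx, rfl⟩
  exact (Finset.card_le_card this).trans Finset.card_image_le

lemma conn_imp_iv {n : ℕ} {X : Finset (Fin n)}
    (h : ConnSet (SimpleGraph.pathGraph n) X) : Iv X := by
  intro a ha b hb c hac hcb
  by_contra hc
  have key : ∀ (x y : ((X : Set (Fin n)))),
      (SimpleGraph.induce (X : Set (Fin n)) (SimpleGraph.pathGraph n)).Reachable x y →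
      x.1 < c → y.1 < c := by
    rintro x y ⟨w⟩
    induction w with
    | nil => exact id
    | @cons u v w' hadj _ ih =>
      intro hu
      apply ih
      have h1 : v.1 ≠ c := by
        intro h2
        exact hc (h2 ▸ v.2)
      rw [SimpleGraph.comap_adj] at hadj
      have h3 := SimpleGraph.pathGraph_adj.1 hadj
      simp only [Function.Embedding.subtype_apply] at h3
      rw [Fin.lt_def] at *
      have h4 : (v.1 : ℕ) ≠ c := fun h => h1 (Fin.ext h)
      omega
  have h1 : a ≠ c := fun h => hc (h ▸ ha)
  have := key ⟨a, ha⟩ ⟨b, hb⟩ (h _ _) (lt_of_le_of_ne hac h1)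
  exact absurd hcb (not_le.2 this)

lemma iv_imp_conn {n : ℕ} {X : Finset (Fin n)} (h : Iv X) :
    ConnSet (SimpleGraph.pathGraph n) X := by
  have key : ∀ (d : ℕ) (a b : Fin n) (ha : a ∈ X) (hb : b ∈ X), a.val + d = b.val →
      (SimpleGraph.induce (X : Set (Fin n)) (SimpleGraph.pathGraph n)).Reachable
        ⟨a, ha⟩ ⟨b, hb⟩ := by
    intro d
    induction d with
    | zero =>
      intro a b ha hb hd
      have : a = b := Fin.ext (by omega)
      subst this
      exact SimpleGraph.Reachable.refl _
    | succ d ih =>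
      intro a b ha hb hd
      have hlt : a.val + 1 < n := by have := b.2; omega
      have hc : (⟨a.val + 1, hlt⟩ : Fin n) ∈ X := by
        apply h a ha b hb
        · rw [Fin.le_def]; simp
        · rw [Fin.le_def]; simp; omega
      refine SimpleGraph.Reachable.trans (SimpleGraph.Adj.reachable ?_)
        (ih ⟨a.val + 1, hlt⟩ b hc hb (by simp; omega))
      rw [SimpleGraph.comap_adj]
      exact SimpleGraph.pathGraph_adj.2 (Or.inl rfl)
  rintro ⟨a, ha⟩ ⟨b, hb⟩
  rcases le_total a b with hab | hab
  · exact key (b.val - a.val) a b ha hb (by rw [Fin.le_def] at hab; omega)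
  · exact (key (a.val - b.val) b a hb ha (by rw [Fin.le_def] at hab; omega)).symm

/-- Any disjoint family of intervals extends to a connected allocation. -/
lemma extend_alloc {n : ℕ} {N : Type*} [Nonempty N] (σ : N → Finset (Fin n))
    (hiv : ∀ i, Iv (σ i)) (hd : ∀ i j, i ≠ j → Disjoint (σ i) (σ j)) :
    ∃ π : N → Finset (Fin n), IsConnAlloc (SimpleGraph.pathGraph n) π ∧ ∀ i, σ i ⊆ π i := by
  classical
  set C : Finset (Fin n) := Finset.univ.filter (fun v => ∃ i, v ∈ σ i) with hC
  have memC : ∀ v, v ∈ C ↔ ∃ i, v ∈ σ i := by intro v; simp [hC]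
  by_cases hne : C.Nonempty
  · have hg : ∃ g : Fin n → Fin n, Monotone g ∧ (∀ v, g v ∈ C) ∧ ∀ v ∈ C, g v = v := by
      refine ⟨fun v => if h : (C.filter (fun c => c ≤ v)).Nonempty
        then (C.filter (fun c => c ≤ v)).max' h else C.min' hne, ?_, ?_, ?_⟩
      · intro v w hvw
        dsimp only
        by_cases h1 : (C.filter (fun c => c ≤ v)).Nonempty
        · have hsub : C.filter (fun c => c ≤ v) ⊆ C.filter (fun c => c ≤ w) := by
            intro c hc
            rw [Finset.mem_filter] at *
            exact ⟨hc.1, hc.2.trans hvw⟩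
          have h2 := h1.mono hsub
          rw [dif_pos h1, dif_pos h2]
          exact Finset.max'_subset h1 hsub
        · rw [dif_neg h1]
          by_cases h2 : (C.filter (fun c => c ≤ w)).Nonempty
          · rw [dif_pos h2]
            exact Finset.min'_le _ _ (Finset.mem_filter.1 (Finset.max'_mem _ h2)).1
          · rw [dif_neg h2]
      · intro v
        dsimp only
        split_ifs with h
        · exact (Finset.mem_filter.1 (Finset.max'_mem _ h)).1
        · exact Finset.min'_mem _ _
      · intro v hv
        dsimp only
        have hv' : v ∈ C.filter (fun c => c ≤ v) := Finset.mem_filter.2 ⟨hv, le_rfl⟩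
        rw [dif_pos ⟨v, hv'⟩]
        apply le_antisymm
        · exact (Finset.mem_filter.1 (Finset.max'_mem _ ⟨v, hv'⟩)).2
        · exact Finset.le_max' _ _ hv'
    obtain ⟨g, hm, hgC, hgid⟩ := hg
    refine ⟨fun i => Finset.univ.filter (fun v => g v ∈ σ i), ⟨?_, ?_, ?_, ?_⟩, ?_⟩
    · intro i; exact Finset.subset_univ _
    · intro i
      apply iv_imp_conn
      intro a ha b hb c h1 h2
      simp only [Finset.mem_filter, Finset.mem_univ, true_and] at *
      exact hiv i _ ha _ hb _ (hm h1) (hm h2)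
    · intro i j hij
      rw [Finset.disjoint_left]
      intro v h1 h2
      simp only [Finset.mem_filter, Finset.mem_univ, true_and] at h1 h2
      exact Finset.disjoint_left.1 (hd i j hij) h1 h2
    · intro v _
      obtain ⟨i, hi⟩ := (memC _).1 (hgC v)
      exact ⟨i, by simpa using hi⟩
    · intro i v hv
      simp only [Finset.mem_filter, Finset.mem_univ, true_and]
      rw [hgid v ((memC v).2 ⟨i, hv⟩)]
      exact hv
  · have hem : ∀ i v, v ∉ σ i := fun i v hv => hne ⟨v, (memC v).2 ⟨i, hv⟩⟩
    let i0 : N := Classical.arbitrary N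
    refine ⟨fun i => if i = i0 then Finset.univ else ∅, ⟨?_, ?_, ?_, ?_⟩, ?_⟩
    · intro i; exact Finset.subset_univ _
    · intro i
      apply iv_imp_conn
      intro a ha b hb c h1 h2
      dsimp only at *
      split_ifs at * with h
      · simp
      · simp at ha
    · intro i j hij
      dsimp only
      split_ifs with h1 h2
      · exact absurd (h1.trans h2.symm) hij
      all_goals simp
    · intro v _
      exact ⟨i0, by simp⟩
    · intro i v hv
      exact absurd hv (hem i v)

/-- What is used of a Pareto-optimal EF1 allocation. -/
structure Good {n : ℕ} {N : Type*} (A π : N → Finset (Fin n)) : Prop where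
  iv : ∀ i, Iv (π i)
  disj : ∀ i j, i ≠ j → Disjoint (π i) (π j)
  po : ∀ σ : N → Finset (Fin n), (∀ i, Iv (σ i)) → (∀ i j, i ≠ j → Disjoint (σ i) (σ j)) →
    (∀ i, (π i ∩ A i).card ≤ (σ i ∩ A i).card) → ∀ i, (σ i ∩ A i).card ≤ (π i ∩ A i).card
  ef : ∀ i j, (π j ∩ A i).card ≤ (π i ∩ A i).card + 1

lemma good_of {n : ℕ} {N : Type*} {A π : N → Finset (Fin n)}
    {u : N → Finset (Fin n) → ℝ} (hu : ∀ i X, u i X = ((X ∩ A i).card : ℝ))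
    (h1 : IsConnAlloc (SimpleGraph.pathGraph n) π)
    (h2 : ParetoOptimal (SimpleGraph.pathGraph n) u π)
    (h3 : EF1 (SimpleGraph.pathGraph n) u π) : Good A π := by
  refine ⟨fun i => conn_imp_iv (h1.2.1 i), h1.2.2.1, ?_, ?_⟩
  · intro σ hiv hd hle i
    by_contra hlt
    push Not at hlt
    have : Nonempty N := ⟨i⟩
    obtain ⟨π', ha, hsub⟩ := extend_alloc σ hiv hd
    have hmono : ∀ j, (σ j ∩ A j).card ≤ (π' j ∩ A j).card := fun j =>
      Finset.card_le_card (Finset.inter_subset_inter_right (hsub j))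
    refine h2 π' ha ⟨?_, i, ?_⟩
    · intro j
      rw [hu, hu]
      exact_mod_cast (hle j).trans (hmono j)
    · rw [hu, hu]
      exact_mod_cast hlt.trans_le (hmono i)
  · intro i j
    rcases h3 i j with h | ⟨v, hv, _, h⟩
    · rw [hu, hu] at h
      have : (π j ∩ A i).card ≤ (π i ∩ A i).card := by exact_mod_cast h
      omega
    · rw [hu, hu] at h
      have h : ((π j).erase v ∩ A i).card ≤ (π i ∩ A i).card := by exact_mod_cast h
      have : π j ∩ A i ⊆ insert v ((π j).erase v ∩ A i) := by
        intro w hw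
        by_cases hwv : w = v
        · simp [hwv]
        · simp only [Finset.mem_inter, Finset.mem_insert, Finset.mem_erase] at *
          tauto
      have h4 := Finset.card_le_card this
      have h5 := Finset.card_insert_le v ((π j).erase v ∩ A i)
      omega

/-- The modification lemma: give new disjoint intervals to the agents in `T`, all the other agents
keep the hull of their approved items. -/
lemma Good.modify {n : ℕ} {N : Type*} {A π : N → Finset (Fin n)} (G : Good A π)
    (T : N → Prop) (g : N → Finset (Fin n)) (hiv : ∀ t, T t → Iv (g t))
    (hd : ∀ t t', T t → T t' → t ≠ t' → Disjoint (g t) (g t'))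
    (hns : ∀ j, ¬ T j → ∀ a ∈ π j, ∀ b ∈ π j, a ∈ A j → b ∈ A j → ∀ t, T t → ∀ v ∈ g t,
      a ≤ v → v ≤ b → False)
    (hle : ∀ t, T t → (π t ∩ A t).card ≤ (g t ∩ A t).card) :
    ∀ t, T t → (g t ∩ A t).card ≤ (π t ∩ A t).card := by
  classical
  let hull : N → Finset (Fin n) := fun j => (π j).filter (fun v =>
    ∃ a ∈ π j, ∃ b ∈ π j, a ∈ A j ∧ b ∈ A j ∧ a ≤ v ∧ v ≤ b)
  let σ : N → Finset (Fin n) := fun j => if T j then g j else hull j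
  have σT : ∀ t, T t → σ t = g t := fun t ht => if_pos ht
  have σN : ∀ t, ¬ T t → σ t = hull t := fun t ht => if_neg ht
  have key := G.po σ ?_ ?_ ?_
  · intro t ht
    have := key t
    rwa [σT t ht] at this
  · intro i
    by_cases hi : T i
    · rw [σT i hi]; exact hiv i hi
    · rw [σN i hi]
      intro x hx y hy c hxc hcy
      simp only [hull, Finset.mem_filter] at *
      obtain ⟨hx1, a, ha, _, _, haA, _, hax, _⟩ := hx
      obtain ⟨hy1, _, _, b, hb, _, hbA, _, hyb⟩ := hy
      exact ⟨G.iv i x hx1 y hy1 c hxc hcy, a, ha, b, hb, haA, hbA, hax.trans hxc, hcy.trans hyb⟩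
  · have hx : ∀ i j, T i → ¬ T j → Disjoint (g i) (hull j) := by
      intro i j hi hj
      rw [Finset.disjoint_left]
      intro v hv hv2
      simp only [hull, Finset.mem_filter] at hv2
      obtain ⟨hx1, a, ha, b, hb, haA, hbA, hax, hvb⟩ := hv2
      exact hns j hj a ha b hb haA hbA i hi v hv hax hvb
    intro i j hij
    by_cases hi : T i <;> by_cases hj : T j
    · rw [σT i hi, σT j hj]; exact hd i j hi hj hij
    · rw [σT i hi, σN j hj]; exact hx i j hi hj
    · rw [σN i hi, σT j hj]; exact (hx j i hj hi).symm
    · rw [σN i hi, σN j hj]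
      exact Finset.disjoint_of_subset_left (Finset.filter_subset _ _)
        (Finset.disjoint_of_subset_right (Finset.filter_subset _ _) (G.disj i j hij))
  · intro i
    by_cases hi : T i
    · rw [σT i hi]; exact hle i hi
    · rw [σN i hi]
      apply Finset.card_le_card
      intro v hv
      rw [Finset.mem_inter] at *
      exact ⟨Finset.mem_filter.2 ⟨hv.1, v, hv.1, v, hv.1, hv.2, hv.2, le_rfl, le_rfl⟩, hv.2⟩

/-- An agent approving exactly two adjacent items nobody else approves gets both. -/
lemma Good.pair {n : ℕ} {N : Type*} {A π : N → Finset (Fin n)} (G : Good A π)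
    (i : N) (p : ℕ) (hp : p + 2 ≤ n) (hA : ∀ v, v ∈ A i ↔ v.val = p ∨ v.val = p + 1)
    (hO : ∀ j, j ≠ i → ∀ v ∈ A j, v.val ≠ p ∧ v.val ≠ p + 1) :
    ∀ v : Fin n, v.val = p ∨ v.val = p + 1 → v ∈ π i := by
  classical
  have hAe : A i = ivl n p (p + 2) := by
    ext v; rw [hA, mem_ivl]; omega
  have hc : (ivl n p (p + 2) ∩ A i).card = 2 := by
    rw [hAe, Finset.inter_self, card_ivl hp]; omega
  have key := G.modify (fun j => j = i) (fun _ => ivl n p (p + 2)) ?_ ?_ ?_ ?_ i rfl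
  · rw [hc, hAe] at key
    have h1 : π i ∩ ivl n p (p + 2) = ivl n p (p + 2) := by
      apply Finset.eq_of_subset_of_card_le Finset.inter_subset_right
      rw [card_ivl hp]; omega
    intro v hv
    have : v ∈ π i ∩ ivl n p (p + 2) := by
      rw [h1, mem_ivl]; omega
    exact (Finset.mem_inter.1 this).1
  · intro _ _; exact iv_ivl _ _ _
  · intro t t' ht ht' hne
    exact absurd (ht.trans ht'.symm) hne
  · intro j hj a ha b hb haA hbA t _ v hv hav hvb
    rw [mem_ivl] at hv
    have h1 := hO j hj a haA
    have h2 := hO j hj b hbA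
    rw [Fin.le_def] at hav hvb
    have hsub : ivl n p (p + 2) ⊆ π j ∩ A i := by
      intro w hw
      rw [Finset.mem_inter, hAe]
      refine ⟨G.iv j a ha b hb w ?_ ?_, hw⟩ <;> rw [mem_ivl] at hw <;> rw [Fin.le_def] <;> omega
    have h3 := Finset.card_le_card hsub
    rw [card_ivl hp] at h3
    have h4 := G.ef i j
    have h5 : 0 < (π i ∩ A i).card := by omega
    obtain ⟨w, hw⟩ := Finset.card_pos.1 h5
    rw [Finset.mem_inter, hAe] at hw
    exact Finset.disjoint_left.1 (G.disj j i hj) (Finset.mem_inter.1 (hsub hw.2)).1 hw.1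
  · rintro t rfl
    rw [hc]
    refine (Finset.card_le_card Finset.inter_subset_right).trans ?_
    rw [hAe, card_ivl hp]; omega

end PathPart

section Instance

abbrev gI {r s : ℕ} (x : Fin (3 * r)) : X3CEF1Agents r s := Sum.inl x
abbrev gD {r s : ℕ} (k : Fin (s - r)) : X3CEF1Agents r s := Sum.inr (Sum.inl k)
abbrev gX {r s : ℕ} (x : Fin (3 * r)) (t : Fin 2) : X3CEF1Agents r s :=
  Sum.inr (Sum.inr (Sum.inl (x, t)))
abbrev gK {r s : ℕ} (k : Fin (s - r)) (t : Fin 2) : X3CEF1Agents r s :=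
  Sum.inr (Sum.inr (Sum.inr (Sum.inl (k, t))))
abbrev gB {r s : ℕ} (k : Fin (s - r)) : X3CEF1Agents r s :=
  Sum.inr (Sum.inr (Sum.inr (Sum.inr (Sum.inl k))))
abbrev gZ {r s : ℕ} (h : Fin s ⊕ Fin (3 * r) ⊕ Fin (s - r)) : X3CEF1Agents r s :=
  Sum.inr (Sum.inr (Sum.inr (Sum.inr (Sum.inr h))))

lemma agent_cases {r s : ℕ} {P : X3CEF1Agents r s → Prop}
    (hI : ∀ x, P (gI x)) (hD : ∀ k, P (gD k)) (hX : ∀ x t, P (gX x t))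
    (hK : ∀ k t, P (gK k t)) (hB : ∀ k, P (gB k)) (hZ : ∀ h, P (gZ h)) : ∀ i, P i := by
  rintro (x | k | ⟨x, t⟩ | ⟨k, t⟩ | k | h)
  · exact hI x
  · exact hD k
  · exact hX x t
  · exact hK k t
  · exact hB k
  · exact hZ h

/-- First position of the separator `P_{z_h}`. -/
def zpos {r s : ℕ} : Fin s ⊕ Fin (3 * r) ⊕ Fin (s - r) → ℕ
  | .inl k => 5 * k.val + 3
  | .inr (.inl x) => 5 * s + 13 * x.val + 11
  | .inr (.inr k) => 5 * s + 39 * r + 12 * k.val + 10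

/-- The instance, with approvals described through positions. -/
structure Inst (r s : ℕ) (S : Fin s → Fin 3 → Fin (3 * r))
    (A : X3CEF1Agents r s → Finset (Fin (17 * s + 27 * r))) : Prop where
  hrs : r ≤ s
  inj : ∀ k, Function.Injective (S k)
  mI : ∀ x v, v ∈ A (gI x) ↔ (∃ (k : Fin s) (j : Fin 3), v.val = 5 * k.val + j.val ∧ S k j = x) ∨
    v.val = 5 * s + 13 * x.val + 3 ∨ v.val = 5 * s + 13 * x.val + 4
  mD : ∀ (k : Fin (s - r)) v, v ∈ A (gD k) ↔
    (∃ k' : Fin s, 5 * k'.val ≤ v.val ∧ v.val < 5 * k'.val + 3) ∨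
    (5 * s + 39 * r + 12 * k.val ≤ v.val ∧ v.val < 5 * s + 39 * r + 12 * k.val + 4) ∨
    (5 * s + 39 * r + 12 * k.val + 6 ≤ v.val ∧ v.val < 5 * s + 39 * r + 12 * k.val + 10)
  mX : ∀ x t v, v ∈ A (gX x t) ↔
    (5 * s + 13 * x.val ≤ v.val ∧ v.val < 5 * s + 13 * x.val + 11)
  mK : ∀ k t v, v ∈ A (gK k t) ↔
    (5 * s + 39 * r + 12 * k.val ≤ v.val ∧ v.val < 5 * s + 39 * r + 12 * k.val + 4) ∨
    (5 * s + 39 * r + 12 * k.val + 6 ≤ v.val ∧ v.val < 5 * s + 39 * r + 12 * k.val + 10)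
  mB : ∀ k v, v ∈ A (gB k) ↔ v.val = 5 * s + 39 * r + 12 * k.val + 4 ∨
    v.val = 5 * s + 39 * r + 12 * k.val + 4 + 1
  mZ : ∀ h v, v ∈ A (gZ h) ↔ v.val = zpos h ∨ v.val = zpos h + 1

variable {r s : ℕ} {S : Fin s → Fin 3 → Fin (3 * r)}
    {A π : X3CEF1Agents r s → Finset (Fin (17 * s + 27 * r))}

lemma zpos_lt (hrs : r ≤ s) (h : Fin s ⊕ Fin (3 * r) ⊕ Fin (s - r)) :
    zpos h + 2 ≤ 17 * s + 27 * r := by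
  rcases h with k | x | k <;> have := Fin.is_lt ‹_› <;> simp only [zpos] <;> omega

lemma zpos_sep {h h' : Fin s ⊕ Fin (3 * r) ⊕ Fin (s - r)} (hne : h ≠ h') :
    zpos h + 2 ≤ zpos h' ∨ zpos h' + 2 ≤ zpos h := by
  rcases h with k | k | k <;> rcases h' with k' | k' | k' <;> have h1 := k.2 <;> have h2 := k'.2 <;>
    simp only [zpos, ne_eq, Sum.inl.injEq, Sum.inr.injEq, Fin.ext_iff] at * <;>
    omega

lemma zpos_not_approved (I : Inst r s S A) (h) (j) (hj : j ≠ gZ h) (v) (hv : v ∈ A j) :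
    v.val ≠ zpos h ∧ v.val ≠ zpos h + 1 := by
  revert hj hv
  refine agent_cases (P := fun j => j ≠ gZ h → v ∈ A j → v.val ≠ zpos h ∧ v.val ≠ zpos h + 1)
    ?_ ?_ ?_ ?_ ?_ ?_ j
  · intro x _ hv
    rw [I.mI] at hv
    have hx := x.2
    rcases hv with ⟨k, j, hv, _⟩ | hv
    · have := k.2
      have := j.2
      rcases h with k' | k' | k' <;> have := k'.2 <;> simp only [zpos] <;> omega
    · rcases h with k' | k' | k' <;> have := k'.2 <;> simp only [zpos] <;> omega
  · intro k _ hv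
    rw [I.mD] at hv
    rcases hv with ⟨k, hv⟩ | hv
    · have := k.2
      rcases h with k' | k' | k' <;> have := k'.2 <;> simp only [zpos] <;> omega
    · rcases h with k' | k' | k' <;> have := k'.2 <;> simp only [zpos] <;> omega
  · intro x t _ hv
    rw [I.mX] at hv
    have hx := x.2
    rcases h with k' | k' | k' <;> have := k'.2 <;> simp only [zpos] <;> omega
  · intro x t _ hv
    rw [I.mK] at hv
    rcases h with k' | k' | k' <;> have := k'.2 <;> simp only [zpos] <;> omega
  · intro k _ hv
    rw [I.mB] at hv
    rcases h with k' | k' | k' <;> have := k'.2 <;> simp only [zpos] <;> omega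
  · intro h' hj hv
    rw [I.mZ] at hv
    have : h' ≠ h := fun e => hj (by rw [e])
    have := zpos_sep this
    omega

lemma bpos_not_approved (I : Inst r s S A) (k) (j) (hj : j ≠ gB k) (v) (hv : v ∈ A j) :
    v.val ≠ 5 * s + 39 * r + 12 * k.val + 4 ∧ v.val ≠ 5 * s + 39 * r + 12 * k.val + 4 + 1 := by
  revert hj hv
  refine agent_cases (P := fun j => j ≠ gB k → v ∈ A j →
    v.val ≠ 5 * s + 39 * r + 12 * k.val + 4 ∧ v.val ≠ 5 * s + 39 * r + 12 * k.val + 4 + 1)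
    ?_ ?_ ?_ ?_ ?_ ?_ j
  · intro x _ hv
    rw [I.mI] at hv
    have hx := x.2
    rcases hv with ⟨k, j, hv, _⟩ | hv
    · have := k.2
      have := j.2
      omega
    · omega
  · intro k _ hv
    rw [I.mD] at hv
    rcases hv with ⟨k, hv⟩ | hv
    · have := k.2
      omega
    · omega
  · intro x t _ hv
    rw [I.mX] at hv
    have hx := x.2
    omega
  · intro x t _ hv
    rw [I.mK] at hv
    omega
  · intro k' hj hv
    rw [I.mB] at hv
    have : k' ≠ k := fun e => hj (by rw [e])
    rw [ne_eq, Fin.ext_iff] at this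
    omega
  · intro h hj hv
    rw [I.mZ] at hv
    rcases h with k' | k' | k' <;> have := k'.2 <;> simp only [zpos] at * <;> omega

lemma zmem (I : Inst r s S A) (G : Good A π) (h) :
    ∀ v, v.val = zpos h ∨ v.val = zpos h + 1 → v ∈ π (gZ h) :=
  G.pair (gZ h) (zpos h) (zpos_lt I.hrs h) (I.mZ h) (zpos_not_approved I h)

lemma bmem (I : Inst r s S A) (G : Good A π) (k) :
    ∀ v, v.val = 5 * s + 39 * r + 12 * k.val + 4 ∨ v.val = 5 * s + 39 * r + 12 * k.val + 4 + 1 →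
      v ∈ π (gB k) :=
  G.pair (gB k) _ (by have := k.2; omega) (I.mB k) (bpos_not_approved I k)

/-- The consequences shared by both directions: bundles are disjoint intervals, and
each separator agent has its separator. -/
structure SepA (π : X3CEF1Agents r s → Finset (Fin (17 * s + 27 * r))) : Prop where
  hrs : r ≤ s
  iv : ∀ i, Iv (π i)
  disj : ∀ i j, i ≠ j → Disjoint (π i) (π j)
  z : ∀ h v, v.val = zpos h ∨ v.val = zpos h + 1 → v ∈ π (gZ h)
  b : ∀ k v, v.val = 5 * s + 39 * r + 12 * k.val + 4 ∨
    v.val = 5 * s + 39 * r + 12 * k.val + 4 + 1 → v ∈ π (gB k)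

lemma sep_of_good (I : Inst r s S A) (G : Good A π) : SepA π :=
  ⟨I.hrs, G.iv, G.disj, zmem I G, bmem I G⟩

lemma SepA.between (P : SepA π) {i j : X3CEF1Agents r s} (hij : j ≠ i) {p : ℕ}
    (hp : ∀ v : Fin (17 * s + 27 * r), v.val = p → v ∈ π i) {a b : Fin (17 * s + 27 * r)}
    (ha : a ∈ π j) (hb : b ∈ π j) : ¬ (a.val ≤ p ∧ p ≤ b.val) := by
  rintro ⟨h1, h2⟩
  have hlt : p < 17 * s + 27 * r := lt_of_le_of_lt h2 b.2
  have h3 : (⟨p, hlt⟩ : Fin (17 * s + 27 * r)) ∈ π j :=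
    P.iv j a ha b hb _ (by rw [Fin.le_def]; exact h1) (by rw [Fin.le_def]; exact h2)
  exact Finset.disjoint_left.1 (P.disj j i hij) h3 (hp _ rfl)

lemma SepA.nz (P : SepA π) {j : X3CEF1Agents r s} (hj : ∀ h, j ≠ gZ h)
    {a b : Fin (17 * s + 27 * r)} (ha : a ∈ π j) (hb : b ∈ π j)
    (h : Fin s ⊕ Fin (3 * r) ⊕ Fin (s - r)) :
    ¬ (a.val ≤ zpos h ∧ zpos h ≤ b.val) ∧ ¬ (a.val ≤ zpos h + 1 ∧ zpos h + 1 ≤ b.val) :=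
  ⟨P.between (hj h) (fun v hv => P.z h v (Or.inl hv)) ha hb,
    P.between (hj h) (fun v hv => P.z h v (Or.inr hv)) ha hb⟩

lemma SepA.blockS (P : SepA π) {j : X3CEF1Agents r s} (hj : ∀ h, j ≠ gZ h) (k : Fin s)
    {a v : Fin (17 * s + 27 * r)} (ha : a ∈ π j) (hv : v ∈ π j)
    (h : 5 * k.val ≤ v.val ∧ v.val < 5 * k.val + 3) :
    5 * k.val ≤ a.val ∧ a.val < 5 * k.val + 3 := by
  have hk := k.2
  constructor
  · by_contra hlt
    have h1 := P.nz hj ha hv (Sum.inl ⟨k.val - 1, by omega⟩)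
    simp only [zpos] at h1
    omega
  · have h1 := P.nz hj hv ha (Sum.inl k)
    simp only [zpos] at h1
    omega

lemma SepA.blockX (P : SepA π) {j : X3CEF1Agents r s} (hj : ∀ h, j ≠ gZ h) (x : Fin (3 * r))
    {a v : Fin (17 * s + 27 * r)} (ha : a ∈ π j) (hv : v ∈ π j)
    (h : 5 * s + 13 * x.val ≤ v.val ∧ v.val < 5 * s + 13 * x.val + 11) :
    5 * s + 13 * x.val ≤ a.val ∧ a.val < 5 * s + 13 * x.val + 11 := by
  have hk := x.2
  have hrs := P.hrs
  constructor
  · by_contra hlt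
    by_cases h0 : x.val = 0
    · have h1 := P.nz hj ha hv (Sum.inl ⟨s - 1, by omega⟩)
      simp only [zpos] at h1
      omega
    · have h1 := P.nz hj ha hv (Sum.inr (Sum.inl ⟨x.val - 1, by omega⟩))
      simp only [zpos] at h1
      omega
  · have h1 := P.nz hj hv ha (Sum.inr (Sum.inl x))
    simp only [zpos] at h1
    omega

lemma SepA.blockD (P : SepA π) {j : X3CEF1Agents r s} (hj : ∀ h, j ≠ gZ h) (k : Fin (s - r))
    {a v : Fin (17 * s + 27 * r)} (ha : a ∈ π j) (hv : v ∈ π j)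
    (h : 5 * s + 39 * r + 12 * k.val ≤ v.val ∧ v.val < 5 * s + 39 * r + 12 * k.val + 10) :
    5 * s + 39 * r + 12 * k.val ≤ a.val ∧ a.val < 5 * s + 39 * r + 12 * k.val + 10 := by
  have hk := k.2
  have hrs := P.hrs
  constructor
  · by_contra hlt
    by_cases h0 : k.val = 0
    · by_cases hr : r = 0
      · have h1 := P.nz hj ha hv (Sum.inl ⟨s - 1, by omega⟩)
        simp only [zpos] at h1
        omega
      · have h1 := P.nz hj ha hv (Sum.inr (Sum.inl ⟨3 * r - 1, by omega⟩))
        simp only [zpos] at h1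
        omega
    · have h1 := P.nz hj ha hv (Sum.inr (Sum.inr ⟨k.val - 1, by omega⟩))
      simp only [zpos] at h1
      omega
  · have h1 := P.nz hj hv ha (Sum.inr (Sum.inr k))
    simp only [zpos] at h1
    omega

/-- Only `i_x`, `a¹_x`, `a²_x` can have a relevant hull meeting `P_x`. -/
lemma SepA.confX (P : SepA π) (I : Inst r s S A) (x : Fin (3 * r)) (j : X3CEF1Agents r s)
    {a b v : Fin (17 * s + 27 * r)} (ha : a ∈ π j) (hb : b ∈ π j) (haA : a ∈ A j) (hbA : b ∈ A j)
    (hav : a ≤ v) (hvb : v ≤ b)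
    (hv : 5 * s + 13 * x.val ≤ v.val ∧ v.val < 5 * s + 13 * x.val + 11) :
    j = gI x ∨ ∃ t, j = gX x t := by
  have hvj := P.iv j a ha b hb v hav hvb
  rw [Fin.le_def] at hav hvb
  have hx := x.2
  have hblk : (∀ h, j ≠ gZ h) → _ := fun hj => P.blockX hj x ha hvj hv
  clear hb hvj ha
  revert haA hbA hblk
  refine agent_cases (P := fun j => a ∈ A j → b ∈ A j → ((∀ h, j ≠ gZ h) →
    5 * s + 13 * x.val ≤ a.val ∧ a.val < 5 * s + 13 * x.val + 11) → j = gI x ∨ ∃ t, j = gX x t)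
    ?_ ?_ ?_ ?_ ?_ ?_ j
  · intro x' haA _ hb
    have hb := hb (by simp)
    rw [I.mI] at haA
    left
    rcases haA with ⟨k, j, h1, _⟩ | h1
    · have := k.2
      have := j.2
      omega
    · have : x' = x := Fin.ext (by omega)
      rw [this]
  · intro k haA _ hb
    have hb := hb (by simp)
    rw [I.mD] at haA
    rcases haA with ⟨k, h1⟩ | h1
    · have := k.2
      omega
    · omega
  · intro x' t haA _ hb
    have hb := hb (by simp)
    rw [I.mX] at haA
    right
    have : x' = x := Fin.ext (by omega)
    exact ⟨t, by rw [this]⟩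
  · intro k t haA _ hb
    have hb := hb (by simp)
    rw [I.mK] at haA
    omega
  · intro k haA _ hb
    have hb := hb (by simp)
    rw [I.mB] at haA
    omega
  · intro h haA hbA _
    rw [I.mZ] at haA hbA
    exfalso
    rcases h with k' | k' | k' <;> have := k'.2 <;> simp only [zpos] at * <;> omega

/-- Only `d_k`, `a¹_k`, `a²_k` can have a relevant hull meeting the halves of `P_{d_k}`. -/
lemma SepA.confD (P : SepA π) (I : Inst r s S A) (k : Fin (s - r)) (j : X3CEF1Agents r s)
    {a b v : Fin (17 * s + 27 * r)} (ha : a ∈ π j) (hb : b ∈ π j) (haA : a ∈ A j) (hbA : b ∈ A j)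
    (hav : a ≤ v) (hvb : v ≤ b)
    (hv : (5 * s + 39 * r + 12 * k.val ≤ v.val ∧ v.val < 5 * s + 39 * r + 12 * k.val + 4) ∨
    (5 * s + 39 * r + 12 * k.val + 6 ≤ v.val ∧ v.val < 5 * s + 39 * r + 12 * k.val + 10)) :
    j = gD k ∨ ∃ t, j = gK k t := by
  have hvj := P.iv j a ha b hb v hav hvb
  rw [Fin.le_def] at hav hvb
  have hx := k.2
  have hblk : (∀ h, j ≠ gZ h) → _ := fun hj => P.blockD hj k ha hvj (by omega)
  clear hb hvj ha
  revert haA hbA hblk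
  refine agent_cases (P := fun j => a ∈ A j → b ∈ A j → ((∀ h, j ≠ gZ h) →
    5 * s + 39 * r + 12 * k.val ≤ a.val ∧ a.val < 5 * s + 39 * r + 12 * k.val + 10) →
      j = gD k ∨ ∃ t, j = gK k t)
    ?_ ?_ ?_ ?_ ?_ ?_ j
  · intro x' haA _ hb
    have hb := hb (by simp)
    rw [I.mI] at haA
    have := x'.2
    rcases haA with ⟨k, j, h1, _⟩ | h1
    · have := k.2
      have := j.2
      omega
    · omega
  · intro k' haA _ hb
    have hb := hb (by simp)
    rw [I.mD] at haA
    rcases haA with ⟨k, h1⟩ | h1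
    · have := k.2
      omega
    · left
      have : k' = k := Fin.ext (by omega)
      rw [this]
  · intro x' t haA _ hb
    have hb := hb (by simp)
    have := x'.2
    rw [I.mX] at haA
    omega
  · intro k' t haA _ hb
    have hb := hb (by simp)
    rw [I.mK] at haA
    right
    have : k' = k := Fin.ext (by omega)
    exact ⟨t, by rw [this]⟩
  · intro k haA hbA hb
    have hb := hb (by simp)
    rw [I.mB] at haA hbA
    omega
  · intro h haA hbA _
    rw [I.mZ] at haA hbA
    exfalso
    rcases h with k' | k' | k' <;> have := k'.2 <;> simp only [zpos] at * <;> omega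

lemma cnt2 {n : ℕ} {X Y I : Finset (Fin n)} (h : Disjoint X Y) :
    (X ∩ I).card + (Y ∩ I).card ≤ I.card := by
  rw [← Finset.card_union_of_disjoint
    (Finset.disjoint_of_subset_left Finset.inter_subset_left
      (Finset.disjoint_of_subset_right Finset.inter_subset_left h))]
  exact Finset.card_le_card (Finset.union_subset Finset.inter_subset_right
    Finset.inter_subset_right)

lemma cnt3 {n : ℕ} {X Y Z I : Finset (Fin n)} (h1 : Disjoint X Y) (h2 : Disjoint X Z)
    (h3 : Disjoint Y Z) : (X ∩ I).card + (Y ∩ I).card + (Z ∩ I).card ≤ I.card := by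
  have h := cnt2 (I := I) (Finset.disjoint_union_left.2 ⟨h2, h3⟩)
  rw [Finset.union_inter_distrib_right, Finset.card_union_of_disjoint
    (Finset.disjoint_of_subset_left Finset.inter_subset_left
      (Finset.disjoint_of_subset_right Finset.inter_subset_left h1))] at h
  exact h

lemma card_two {n : ℕ} {X Y : Finset (Fin n)} {a b c d : ℕ} (hbc : b ≤ c)
    (hY : ∀ v ∈ X, v ∈ Y ↔ (a ≤ v.val ∧ v.val < b) ∨ (c ≤ v.val ∧ v.val < d)) :
    (X ∩ Y).card = (X ∩ ivl n a b).card + (X ∩ ivl n c d).card := by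
  rw [← Finset.card_union_of_disjoint]
  · congr 1
    ext v
    simp only [Finset.mem_inter, Finset.mem_union, mem_ivl]
    constructor
    · rintro ⟨h1, h2⟩
      have := (hY v h1).1 h2
      tauto
    · intro h
      have h1 : v ∈ X := by tauto
      exact ⟨h1, (hY v h1).2 (by tauto)⟩
  · rw [Finset.disjoint_left]
    intro v h1 h2
    simp only [Finset.mem_inter, mem_ivl] at h1 h2
    omega

lemma SepA.zero_or (P : SepA π) {i j : X3CEF1Agents r s} (hij : j ≠ i) {p a b c d : ℕ}
    (hp : ∀ v : Fin (17 * s + 27 * r), v.val = p → v ∈ π i) (h1 : b ≤ p) (h2 : p ≤ c) :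
    (π j ∩ ivl _ a b).card = 0 ∨ (π j ∩ ivl _ c d).card = 0 := by
  by_contra h
  push Not at h
  obtain ⟨v, hv⟩ := Finset.card_pos.1 (Nat.pos_of_ne_zero h.1)
  obtain ⟨w, hw⟩ := Finset.card_pos.1 (Nat.pos_of_ne_zero h.2)
  rw [Finset.mem_inter, mem_ivl] at hv hw
  exact P.between hij hp hv.1 hw.1 (by omega)

/-- Each `d_k` owns a whole `P_S`. -/
lemma dkey (I : Inst r s S A) (G : Good A π) (k : Fin (s - r)) :
    ∃ k' : Fin s, ∀ v : Fin (17 * s + 27 * r), 5 * k'.val ≤ v.val → v.val < 5 * k'.val + 3 →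
      v ∈ π (gD k) := by
  have P := sep_of_good I G
  have hk := k.2
  obtain ⟨o, ho⟩ : ∃ o, o = 5 * s + 39 * r + 12 * k.val := ⟨_, rfl⟩
  have hon : o + 10 ≤ 17 * s + 27 * r := by omega
  -- the three agents
  have hApp : ∀ c : X3CEF1Agents r s, (c = gK k 0 ∨ c = gK k 1 ∨ c = gD k) →
      ∀ v : Fin (17 * s + 27 * r), o ≤ v.val → (v ∈ A c ↔ (o ≤ v.val ∧ v.val < o + 4) ∨
        (o + 6 ≤ v.val ∧ v.val < o + 10)) := by
    rintro c (rfl | rfl | rfl) v hv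
    · rw [I.mK, ho]
    · rw [I.mK, ho]
    · rw [I.mD, ← ho]
      constructor
      · rintro (⟨k', h⟩ | h)
        · have := k'.2
          omega
        · exact h
      · exact Or.inr
  have hnz : ∀ c : X3CEF1Agents r s, (c = gK k 0 ∨ c = gK k 1 ∨ c = gD k) → ∀ h, c ≠ gZ h := by
    rintro c (rfl | rfl | rfl) h <;> simp
  have hnb : ∀ c : X3CEF1Agents r s, (c = gK k 0 ∨ c = gK k 1 ∨ c = gD k) → c ≠ gB k := by
    rintro c (rfl | rfl | rfl) <;> simp
  have f1 : ∀ c : X3CEF1Agents r s, (c = gK k 0 ∨ c = gK k 1 ∨ c = gD k) →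
      (π c ∩ ivl _ o (o + 4)).card = 0 ∨ (π c ∩ ivl _ (o + 6) (o + 10)).card = 0 :=
    fun c hc => P.zero_or (hnb c hc) (p := o + 4)
      (fun v hv => P.b k v (Or.inl (by omega))) (by omega) (by omega)
  -- value when meeting the block
  have f3' : ∀ c : X3CEF1Agents r s, (c = gK k 0 ∨ c = gK k 1 ∨ c = gD k) →
      ∀ v ∈ π c, o ≤ v.val → v.val < o + 10 → (π c ∩ A c).card =
        (π c ∩ ivl _ o (o + 4)).card + (π c ∩ ivl _ (o + 6) (o + 10)).card := by
    intro c hc v hv h1 h2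
    apply card_two (by omega)
    intro w hw
    apply hApp c hc
    have := P.blockD (hnz c hc) k hw hv (by omega)
    omega
  have f3d : (π (gD k) ∩ ivl _ o (o + 4)).card + (π (gD k) ∩ ivl _ (o + 6) (o + 10)).card = 0 ∨
      (π (gD k) ∩ A (gD k)).card =
        (π (gD k) ∩ ivl _ o (o + 4)).card + (π (gD k) ∩ ivl _ (o + 6) (o + 10)).card := by
    by_cases h : (π (gD k) ∩ ivl _ o (o + 4)).card + (π (gD k) ∩ ivl _ (o + 6) (o + 10)).card = 0
    · exact Or.inl h
    · right
      have : 0 < (π (gD k) ∩ ivl _ o (o + 4)).card ∨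
        0 < (π (gD k) ∩ ivl _ (o + 6) (o + 10)).card := by omega
      rcases this with h | h
      all_goals
        obtain ⟨v, hv⟩ := Finset.card_pos.1 h
        rw [Finset.mem_inter, mem_ivl] at hv
        exact f3' _ (by simp) v hv.1 (by omega) (by omega)
  have f3a : ∀ t, (π (gK k t) ∩ A (gK k t)).card =
      (π (gK k t) ∩ ivl _ o (o + 4)).card + (π (gK k t) ∩ ivl _ (o + 6) (o + 10)).card := by
    intro t
    apply card_two (by omega)
    intro w _
    rw [I.mK, ho]
  have f5 : ∀ c c' : X3CEF1Agents r s, (c = gK k 0 ∨ c = gK k 1 ∨ c = gD k) →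
      (π c' ∩ ivl _ o (o + 4)).card + (π c' ∩ ivl _ (o + 6) (o + 10)).card ≤
        (π c ∩ A c).card + 1 := by
    intro c c' hc
    rw [← card_two (Y := A (gK k 0)) (by omega) (fun v _ => by rw [I.mK, ho])]
    refine le_trans (Finset.card_le_card ?_) (G.ef c c')
    intro v hv
    rw [Finset.mem_inter] at *
    refine ⟨hv.1, (hApp c hc v ?_).2 ?_⟩ <;> have := (I.mK k 0 v).1 hv.2 <;> omega
  have f4 : ∀ q, (q = o ∨ q = o + 6) → ∀ c : X3CEF1Agents r s,
      (c = gK k 0 ∨ c = gK k 1 ∨ c = gD k) →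
      (π c ∩ A c).card ≤ 4 → (∀ c' : X3CEF1Agents r s, (c' = gK k 0 ∨ c' = gK k 1 ∨ c' = gD k) →
        c' ≠ c → (π c' ∩ ivl _ q (q + 4)).card = 0) → 4 ≤ (π c ∩ A c).card := by
    intro q hq c hc hle hoth
    have hcard : (ivl (17 * s + 27 * r) q (q + 4) ∩ A c).card = 4 := by
      have : ivl (17 * s + 27 * r) q (q + 4) ∩ A c = ivl (17 * s + 27 * r) q (q + 4) := by
        rw [Finset.inter_eq_left]
        intro v hv
        rw [mem_ivl] at hv
        exact (hApp c hc v (by omega)).2 (by omega)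
      rw [this, card_ivl (by omega)]
      omega
    have key := G.modify (fun j => j = c) (fun _ => ivl _ q (q + 4))
      (fun _ _ => iv_ivl _ _ _) (fun t t' ht ht' hne => absurd (ht.trans ht'.symm) hne) ?_ ?_ c rfl
    · rw [hcard] at key
      exact key
    · intro j hj a ha b hb haA hbA t _ v hv hav hvb
      have hv' := hv
      rw [mem_ivl] at hv'
      have hj' : j = gK k 0 ∨ j = gK k 1 ∨ j = gD k := by
        rcases P.confD I k j ha hb haA hbA hav hvb (by omega) with h | ⟨t, h⟩
        · exact Or.inr (Or.inr h)
        · fin_cases t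
          · exact Or.inl h
          · exact Or.inr (Or.inl h)
      have h0 := Finset.card_eq_zero.1 (hoth j hj' hj)
      have : v ∈ π j ∩ ivl _ q (q + 4) :=
        Finset.mem_inter.2 ⟨P.iv j a ha b hb v hav hvb, hv⟩
      rw [h0] at this
      simp at this
    · rintro t rfl
      rw [hcard]
      exact hle
  have ne1 : (gK k 0 : X3CEF1Agents r s) ≠ gK k 1 := by simp
  have ne2 : (gK k 0 : X3CEF1Agents r s) ≠ gD k := by simp
  have ne3 : (gK k 1 : X3CEF1Agents r s) ≠ gD k := by simp
  have f2 : ∀ q, q + 4 ≤ 17 * s + 27 * r → (π (gK k 0) ∩ ivl _ q (q + 4)).card +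
      (π (gK k 1) ∩ ivl _ q (q + 4)).card + (π (gD k) ∩ ivl _ q (q + 4)).card ≤ 4 := by
    intro q hq
    have := cnt3 (I := ivl _ q (q + 4)) (P.disj _ _ ne1) (P.disj _ _ ne2) (P.disj _ _ ne3)
    rw [card_ivl hq] at this
    omega
  have g0 : ∀ q, (q = o ∨ q = o + 6) → (π (gK k 0) ∩ A (gK k 0)).card ≤ 4 →
      (π (gK k 1) ∩ ivl _ q (q + 4)).card = 0 → (π (gD k) ∩ ivl _ q (q + 4)).card = 0 →
      4 ≤ (π (gK k 0) ∩ A (gK k 0)).card := by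
    intro q hq h1 h2 h3
    refine f4 q hq _ (by simp) h1 ?_
    rintro c' (rfl | rfl | rfl) hne
    · exact absurd rfl hne
    · exact h2
    · exact h3
  have g1 : ∀ q, (q = o ∨ q = o + 6) → (π (gK k 1) ∩ A (gK k 1)).card ≤ 4 →
      (π (gK k 0) ∩ ivl _ q (q + 4)).card = 0 → (π (gD k) ∩ ivl _ q (q + 4)).card = 0 →
      4 ≤ (π (gK k 1) ∩ A (gK k 1)).card := by
    intro q hq h1 h2 h3
    refine f4 q hq _ (by simp) h1 ?_
    rintro c' (rfl | rfl | rfl) hne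
    · exact h2
    · exact absurd rfl hne
    · exact h3
  have g2 : ∀ q, (q = o ∨ q = o + 6) → (π (gD k) ∩ A (gD k)).card ≤ 4 →
      (π (gK k 0) ∩ ivl _ q (q + 4)).card = 0 → (π (gK k 1) ∩ ivl _ q (q + 4)).card = 0 →
      4 ≤ (π (gD k) ∩ A (gD k)).card := by
    intro q hq h1 h2 h3
    refine f4 q hq _ (by simp) h1 ?_
    rintro c' (rfl | rfl | rfl) hne
    · exact h2
    · exact h3
    · exact absurd rfl hne
  have hfin : 3 ≤ (π (gD k) ∩ A (gD k)).card ∧ (π (gD k) ∩ ivl _ o (o + 4)).card = 0 ∧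
      (π (gD k) ∩ ivl _ (o + 6) (o + 10)).card = 0 := by
    have a1 := f1 (gK k 0) (by simp)
    have a2 := f1 (gK k 1) (by simp)
    have a3 := f1 (gD k) (by simp)
    have a4 := f2 o (by omega)
    have a5 := f2 (o + 6) (by omega)
    have a6 := f3a 0
    have a7 := f3a 1
    have b1 := f5 (gK k 0) (gK k 1) (by simp)
    have b2 := f5 (gK k 0) (gD k) (by simp)
    have b3 := f5 (gK k 1) (gK k 0) (by simp)
    have b4 := f5 (gK k 1) (gD k) (by simp)
    have b5 := f5 (gD k) (gK k 0) (by simp)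
    have b6 := f5 (gD k) (gK k 1) (by simp)
    have c1 := g0 o (by simp)
    have c2 := g0 (o + 6) (by simp)
    have c3 := g1 o (by simp)
    have c4 := g1 (o + 6) (by simp)
    have c5 := g2 o (by simp)
    have c6 := g2 (o + 6) (by simp)
    simp only [Nat.add_assoc, Nat.reduceAdd] at *
    clear g0 g1 g2 f1 f2 f3a f5 f4 f3' hApp
    generalize (π (gK k 0) ∩ A (gK k 0)).card = A0 at *
    generalize (π (gK k 1) ∩ A (gK k 1)).card = A1 at *
    generalize (π (gD k) ∩ A (gD k)).card = A2 at *
    generalize (π (gK k 0) ∩ ivl _ o (o + 4)).card = L0 at *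
    generalize (π (gK k 1) ∩ ivl _ o (o + 4)).card = L1 at *
    generalize (π (gD k) ∩ ivl _ o (o + 4)).card = L2 at *
    generalize (π (gK k 0) ∩ ivl _ (o + 6) (o + 10)).card = R0 at *
    generalize (π (gK k 1) ∩ ivl _ (o + 6) (o + 10)).card = R1 at *
    generalize (π (gD k) ∩ ivl _ (o + 6) (o + 10)).card = R2 at *
    clear I G P hk ho hon hnz hnb ne1 ne2 ne3
    rcases a1 with a1 | a1 <;> rcases a2 with a2 | a2 <;> rcases a3 with a3 | a3 <;> omega
  obtain ⟨hd, hL, hR⟩ := hfin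
  obtain ⟨v, hv⟩ := Finset.card_pos.1 (show 0 < (π (gD k) ∩ A (gD k)).card by omega)
  rw [Finset.mem_inter] at hv
  rcases (I.mD k v).1 hv.2 with ⟨k', hk'⟩ | hk' | hk'
  · refine ⟨k', ?_⟩
    have hsub : π (gD k) ∩ A (gD k) ⊆ ivl _ (5 * k'.val) (5 * k'.val + 3) := by
      intro w hw
      rw [Finset.mem_inter] at hw
      rw [mem_ivl]
      exact P.blockS (by simp) k' hw.1 hv.1 hk'
    have heq := Finset.eq_of_subset_of_card_le hsub
      ((card_ivl_le _ _ _).trans (by omega))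
    intro w h1 h2
    have : w ∈ π (gD k) ∩ A (gD k) := by
      rw [heq, mem_ivl]; omega
    exact (Finset.mem_inter.1 this).1
  · have : v ∈ π (gD k) ∩ ivl _ o (o + 4) := by
      rw [Finset.mem_inter, mem_ivl]; exact ⟨hv.1, by omega⟩
    rw [Finset.card_eq_zero.1 hL] at this
    simp at this
  · have : v ∈ π (gD k) ∩ ivl _ (o + 6) (o + 10) := by
      rw [Finset.mem_inter, mem_ivl]; exact ⟨hv.1, by omega⟩
    rw [Finset.card_eq_zero.1 hR] at this
    simp at this

/-- Redistributing `P_x` between `a¹_x` and `a²_x`, around the items held by `i_x`. -/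
lemma xmod (I : Inst r s S A) (G : Good A π) (x : Fin (3 * r)) (p q : X3CEF1Agents r s)
    (hpq : (p = gX x 0 ∧ q = gX x 1) ∨ (p = gX x 1 ∧ q = gX x 0)) (m1 m2 : ℕ)
    (hm : m1 ≤ m2) (hm2 : m2 ≤ 11)
    (hi : ∀ v ∈ π (gI x), v ∈ A (gI x) → 5 * s + 13 * x.val + m1 ≤ v.val ∧
      v.val < 5 * s + 13 * x.val + m2)
    (h1 : (π p ∩ A p).card ≤ m1) (h2 : (π q ∩ A q).card ≤ 11 - m2) :
    m1 ≤ (π p ∩ A p).card ∧ 11 - m2 ≤ (π q ∩ A q).card := by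
  have P := sep_of_good I G
  have hrs := I.hrs
  have hx := x.2
  obtain ⟨o, ho⟩ : ∃ o, o = 5 * s + 13 * x.val := ⟨_, rfl⟩
  have hon : o + 11 ≤ 17 * s + 27 * r := by omega
  have hne : q ≠ p := by
    rcases hpq with ⟨rfl, rfl⟩ | ⟨rfl, rfl⟩ <;> simp
  have hA : ∀ c, (c = p ∨ c = q) → A c = ivl _ o (o + 11) := by
    have : ∀ t, A (gX x t) = ivl _ o (o + 11) := by
      intro t
      ext v
      rw [I.mX, mem_ivl, ho]
    intro c hc
    rcases hpq with ⟨rfl, rfl⟩ | ⟨rfl, rfl⟩ <;> rcases hc with rfl | rfl <;> exact this _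
  let g : X3CEF1Agents r s → Finset (Fin (17 * s + 27 * r)) :=
    fun j => if j = p then ivl _ o (o + m1) else ivl _ (o + m2) (o + 11)
  have gp : g p = ivl _ o (o + m1) := if_pos rfl
  have gq : g q = ivl _ (o + m2) (o + 11) := if_neg hne
  have cp : (g p ∩ A p).card = m1 := by
    rw [gp, hA p (Or.inl rfl), Finset.inter_eq_left.2, card_ivl (by omega)]
    · omega
    · intro v hv
      rw [mem_ivl] at *
      omega
  have cq : (g q ∩ A q).card = 11 - m2 := by
    rw [gq, hA q (Or.inr rfl), Finset.inter_eq_left.2, card_ivl (by omega)]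
    · omega
    · intro v hv
      rw [mem_ivl] at *
      omega
  have hdis : Disjoint (g p) (g q) := by
    rw [gp, gq, Finset.disjoint_left]
    intro v h1 h2
    rw [mem_ivl] at h1 h2
    omega
  have key := G.modify (fun j => j = p ∨ j = q) g ?_ ?_ ?_ ?_
  · have k1 := key p (Or.inl rfl)
    have k2 := key q (Or.inr rfl)
    omega
  · rintro t (rfl | rfl)
    · rw [gp]; exact iv_ivl _ _ _
    · rw [gq]; exact iv_ivl _ _ _
  · rintro t t' (rfl | rfl) (rfl | rfl) hn
    · exact absurd rfl hn
    · exact hdis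
    · exact hdis.symm
    · exact absurd rfl hn
  · intro j hj a ha b hb haA hbA t ht v hv hav hvb
    have hv' : (o ≤ v.val ∧ v.val < o + m1) ∨ (o + m2 ≤ v.val ∧ v.val < o + 11) := by
      rcases ht with rfl | rfl
      · rw [gp, mem_ivl] at hv; exact Or.inl hv
      · rw [gq, mem_ivl] at hv; exact Or.inr hv
    rcases P.confX I x j ha hb haA hbA hav hvb (by omega) with rfl | ⟨t', rfl⟩
    · have e1 := hi a ha haA
      have e2 := hi b hb hbA
      rw [Fin.le_def] at hav hvb
      omega
    · apply hj
      fin_cases t' <;> rcases hpq with ⟨rfl, rfl⟩ | ⟨rfl, rfl⟩ <;> simp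
  · rintro t (rfl | rfl)
    · rw [cp]; exact h1
    · rw [cq]; exact h2

/-- Each `i_x` owns an item of some `P_S` corresponding to `x`. -/
lemma xkey (I : Inst r s S A) (G : Good A π) (x : Fin (3 * r)) :
    ∃ (k : Fin s) (j : Fin 3) (v : Fin (17 * s + 27 * r)), S k j = x ∧
      v.val = 5 * k.val + j.val ∧ v ∈ π (gI x) := by
  by_contra hno
  push Not at hno
  have P := sep_of_good I G
  have hrs := I.hrs
  have hx := x.2
  obtain ⟨o, ho⟩ : ∃ o, o = 5 * s + 13 * x.val := ⟨_, rfl⟩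
  have hon : o + 11 ≤ 17 * s + 27 * r := by omega
  have hap : ∀ v ∈ π (gI x), v ∈ A (gI x) → v.val = o + 3 ∨ v.val = o + 4 := by
    intro v hv hvA
    rcases (I.mI x v).1 hvA with ⟨k, j, h1, h2⟩ | h
    · exact absurd hv (hno k j v h2 h1)
    · rw [ho]; exact h
  have hA : ∀ t, A (gX x t) = ivl _ o (o + 11) := by
    intro t
    ext v
    rw [I.mX, mem_ivl, ho]
  have ne1 : (gX x 0 : X3CEF1Agents r s) ≠ gX x 1 := by simp
  have e1 := G.ef (gX x 0) (gX x 1)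
  have e2 := G.ef (gX x 1) (gX x 0)
  have hsum := cnt2 (I := ivl _ o (o + 11)) (P.disj _ _ ne1)
  rw [card_ivl hon] at hsum
  have hm01 := xmod I G x (gX x 0) (gX x 1) (Or.inl ⟨rfl, rfl⟩)
  have hm10 := xmod I G x (gX x 1) (gX x 0) (Or.inr ⟨rfl, rfl⟩)
  rw [hA] at e1 e2
  rw [hA, hA] at hm01 hm10
  by_cases hz : ∃ v ∈ π (gI x), v ∈ A (gI x)
  · -- `i_x` holds part of `P_x`
    obtain ⟨m1, m2, hm, hin, hall⟩ : ∃ m1 m2, ((m1 = 3 ∧ m2 = 4) ∨ (m1 = 4 ∧ m2 = 5) ∨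
        (m1 = 3 ∧ m2 = 5)) ∧ (∀ v ∈ π (gI x), v ∈ A (gI x) → o + m1 ≤ v.val ∧
          v.val < o + m2) ∧ (∀ v : Fin (17 * s + 27 * r), o + m1 ≤ v.val → v.val < o + m2 →
          v ∈ π (gI x)) := by
      have q3 : ∀ v : Fin (17 * s + 27 * r), v.val = o + 3 → v = ⟨o + 3, by omega⟩ :=
        fun v hv => Fin.ext hv
      have q4 : ∀ v : Fin (17 * s + 27 * r), v.val = o + 4 → v = ⟨o + 4, by omega⟩ :=
        fun v hv => Fin.ext hv
      by_cases h3 : (⟨o + 3, by omega⟩ : Fin (17 * s + 27 * r)) ∈ π (gI x) <;>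
        by_cases h4 : (⟨o + 4, by omega⟩ : Fin (17 * s + 27 * r)) ∈ π (gI x)
      · refine ⟨3, 5, by simp, ?_, ?_⟩
        · intro v hv hvA
          have := hap v hv hvA
          omega
        · intro v g1 g2
          have : v.val = o + 3 ∨ v.val = o + 4 := by omega
          rcases this with h | h
          · rw [q3 v h]; exact h3
          · rw [q4 v h]; exact h4
      · refine ⟨3, 4, by simp, ?_, ?_⟩
        · intro v hv hvA
          rcases hap v hv hvA with h | h
          · omega
          · rw [q4 v h] at hv; exact absurd hv h4
        · intro v g1 g2
          have : v.val = o + 3 := by omega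
          rw [q3 v this]; exact h3
      · refine ⟨4, 5, by simp, ?_, ?_⟩
        · intro v hv hvA
          rcases hap v hv hvA with h | h
          · rw [q3 v h] at hv; exact absurd hv h3
          · omega
        · intro v g1 g2
          have : v.val = o + 4 := by omega
          rw [q4 v this]; exact h4
      · obtain ⟨v, hv, hvA⟩ := hz
        exfalso
        rcases hap v hv hvA with h | h
        · rw [q3 v h] at hv; exact absurd hv h3
        · rw [q4 v h] at hv; exact absurd hv h4
    have hnI : ∀ t, (gX x t : X3CEF1Agents r s) ≠ gI x := by intro t; simp
    have side : ∀ t, (π (gX x t) ∩ ivl _ o (o + m1)).card = 0 ∨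
        (π (gX x t) ∩ ivl _ (o + m2) (o + 11)).card = 0 := by
      intro t
      exact P.zero_or (hnI t) (p := o + m1) (fun v hv => hall v (by omega) (by omega))
        le_rfl (by omega)
    have tot : ∀ t, (π (gX x t) ∩ ivl _ o (o + 11)).card = (π (gX x t) ∩ ivl _ o (o + m1)).card +
        (π (gX x t) ∩ ivl _ (o + m2) (o + 11)).card := by
      intro t
      apply card_two (by omega)
      intro v hv
      have : ¬ (o + m1 ≤ v.val ∧ v.val < o + m2) := fun h =>
        Finset.disjoint_left.1 (P.disj _ _ (hnI t)) hv (hall v h.1 h.2)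
      rw [mem_ivl]
      omega
    have c1 := cnt2 (I := ivl _ o (o + m1)) (P.disj _ _ ne1)
    have c2 := cnt2 (I := ivl _ (o + m2) (o + 11)) (P.disj _ _ ne1)
    rw [card_ivl (by omega)] at c1 c2
    have hm01 := hm01 m1 m2 (by omega) (by omega) (by rw [← ho]; exact hin)
    have hm10 := hm10 m1 m2 (by omega) (by omega) (by rw [← ho]; exact hin)
    have s0 := side 0
    have s1 := side 1
    have t0 := tot 0
    have t1 := tot 1
    clear side tot hall hin hap hno hA P G I
    generalize (π (gX x 0) ∩ ivl _ o (o + 11)).card = A0 at *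
    generalize (π (gX x 1) ∩ ivl _ o (o + 11)).card = A1 at *
    generalize (π (gX x 0) ∩ ivl _ o (o + m1)).card = L0 at *
    generalize (π (gX x 1) ∩ ivl _ o (o + m1)).card = L1 at *
    generalize (π (gX x 0) ∩ ivl _ (o + m2) (o + 11)).card = R0 at *
    generalize (π (gX x 1) ∩ ivl _ (o + m2) (o + 11)).card = R1 at *
    rcases hm with ⟨rfl, rfl⟩ | ⟨rfl, rfl⟩ | ⟨rfl, rfl⟩ <;> rcases s0 with s0 | s0 <;>
      rcases s1 with s1 | s1 <;> omega
  · -- `i_x` has value zero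
    push Not at hz
    have hm := hm01 (π (gX x 0) ∩ ivl _ o (o + 11)).card (π (gX x 0) ∩ ivl _ o (o + 11)).card
      le_rfl (by omega) (fun v hv hvA => absurd hvA (hz v hv)) le_rfl (by omega)
    have h0 : (π (gI x) ∩ A (gI x)).card = 0 := by
      rw [Finset.card_eq_zero, Finset.eq_empty_iff_forall_notMem]
      intro v hv
      rw [Finset.mem_inter] at hv
      exact hz v hv.1 hv.2
    -- the owner of the first item
    have hcov : ∃ t, (⟨o, by omega⟩ : Fin (17 * s + 27 * r)) ∈ π (gX x t) := by
      by_contra hc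
      push Not at hc
      have hs : ∀ t, π (gX x t) ∩ ivl _ o (o + 11) = π (gX x t) ∩ ivl _ (o + 1) (o + 11) := by
        intro t
        ext v
        simp only [Finset.mem_inter, mem_ivl]
        constructor
        · rintro ⟨h1, h2⟩
          refine ⟨h1, ?_⟩
          have : v.val ≠ o := by
            intro h
            have e : v = ⟨o, by omega⟩ := Fin.ext h
            rw [e] at h1
            exact hc t h1
          omega
        · rintro ⟨h1, h2⟩
          exact ⟨h1, by omega⟩
      have := cnt2 (I := ivl _ (o + 1) (o + 11)) (P.disj _ _ ne1)
      rw [← hs 0, ← hs 1, card_ivl hon] at this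
      omega
    obtain ⟨t, ht⟩ := hcov
    have h5 : 5 ≤ (π (gX x t) ∩ ivl _ o (o + 11)).card := by
      fin_cases t
      · change 5 ≤ (π (gX x 0) ∩ ivl _ o (o + 11)).card
        omega
      · change 5 ≤ (π (gX x 1) ∩ ivl _ o (o + 11)).card
        omega
    have hbig : ∃ w ∈ π (gX x t), o + 4 ≤ w.val := by
      by_contra hc
      push Not at hc
      have : π (gX x t) ∩ ivl _ o (o + 11) ⊆ ivl _ o (o + 4) := by
        intro v hv
        rw [Finset.mem_inter, mem_ivl] at hv
        rw [mem_ivl]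
        have := hc v hv.1
        omega
      have := (Finset.card_le_card this).trans (card_ivl_le _ _ _)
      omega
    obtain ⟨w, hw, hwo⟩ := hbig
    have hsub : ivl _ (o + 3) (o + 5) ⊆ π (gX x t) ∩ A (gI x) := by
      intro v hv
      rw [mem_ivl] at hv
      rw [Finset.mem_inter, I.mI]
      refine ⟨P.iv _ _ ht _ hw v ?_ ?_, Or.inr (by omega)⟩
      · rw [Fin.le_def]; change o ≤ v.val; omega
      · rw [Fin.le_def]; omega
    have h6 := Finset.card_le_card hsub
    rw [card_ivl (by omega)] at h6
    have h7 := G.ef (gI x) (gX x t)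
    omega

lemma forward (I : Inst r s S A) (G : Good A π) :
    ∃ S' : Finset (Fin s), S'.card = r ∧ ∀ x : Fin (3 * r), ∃ k ∈ S', ∃ j, S k j = x := by
  classical
  choose f hf using dkey I G
  have hrs := I.hrs
  have hinj : Function.Injective f := by
    intro k k' h
    by_contra hne
    have hlt := (f k).2
    have h1 := hf k ⟨5 * (f k).val, by omega⟩ le_rfl (by simp)
    have h2 := hf k' ⟨5 * (f k).val, by omega⟩ (by simp [h]) (by simp [h])
    refine Finset.disjoint_left.1 (G.disj (gD k) (gD k') ?_) h1 h2
    simpa using hne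
  refine ⟨(Finset.univ.image f)ᶜ, ?_, ?_⟩
  · rw [Finset.card_compl, Finset.card_image_of_injective _ hinj]
    simp only [Fintype.card_fin, Finset.card_univ]
    omega
  · intro x
    obtain ⟨k, j, v, h1, h2, h3⟩ := xkey I G x
    refine ⟨k, ?_, j, h1⟩
    rw [Finset.mem_compl, Finset.mem_image]
    rintro ⟨k', _, rfl⟩
    have := hf k' v (by omega) (by omega)
    exact Finset.disjoint_left.1 (G.disj (gD k') (gI x) (by simp)) this h3

/-- First position of the bundle of an agent in the allocation built from an exact cover. -/
def lo (kx : Fin (3 * r) → Fin s) (jx : Fin (3 * r) → Fin 3) (e : Fin (s - r) → Fin s) :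
    X3CEF1Agents r s → ℕ
  | .inl x => 5 * (kx x).val + (jx x).val
  | .inr (.inl k) => 5 * (e k).val
  | .inr (.inr (.inl (x, t))) => 5 * s + 13 * x.val + 5 * t.val
  | .inr (.inr (.inr (.inl (k, t)))) => 5 * s + 39 * r + 12 * k.val + 6 * t.val
  | .inr (.inr (.inr (.inr (.inl k)))) => 5 * s + 39 * r + 12 * k.val + 4
  | .inr (.inr (.inr (.inr (.inr h)))) => zpos h

/-- Length of the bundle of an agent in the allocation built from an exact cover. -/
def len : X3CEF1Agents r s → ℕ
  | .inl _ => 1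
  | .inr (.inl _) => 3
  | .inr (.inr (.inl (_, t))) => 5 + t.val
  | .inr (.inr (.inr (.inl _))) => 4
  | .inr (.inr (.inr (.inr (.inl _)))) => 2
  | .inr (.inr (.inr (.inr (.inr _)))) => 2

lemma blockone (I : Inst r s S A) (x : Fin (3 * r)) (k : Fin s)
    {X : Finset (Fin (17 * s + 27 * r))}
    (hX : ∀ v ∈ X, v ∈ A (gI x) → 5 * k.val ≤ v.val ∧ v.val < 5 * k.val + 3) :
    (X ∩ A (gI x)).card ≤ 1 := by
  have hk := k.2
  have key : ∀ v ∈ X ∩ A (gI x), ∃ j : Fin 3, v.val = 5 * k.val + j.val ∧ S k j = x := by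
    intro v hv
    rw [Finset.mem_inter] at hv
    have h1 := hX v hv.1 hv.2
    rcases (I.mI x v).1 hv.2 with ⟨k1, j, h2, h3⟩ | h2
    · have := j.2
      have : k1 = k := Fin.ext (by omega)
      subst this
      exact ⟨j, h2, h3⟩
    · omega
  rw [Finset.card_le_one]
  intro v hv w hw
  obtain ⟨j, h1, h2⟩ := key v hv
  obtain ⟨j', h3, h4⟩ := key w hw
  have := I.inj k (h2.trans h4.symm)
  subst this
  exact Fin.ext (by omega)

lemma card_B (I : Inst r s S A) (k) (X : Finset (Fin (17 * s + 27 * r))) :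
    (X ∩ A (gB k)).card ≤ 2 := by
  have : X ∩ A (gB k) ⊆ ivl _ (5 * s + 39 * r + 12 * k.val + 4)
      (5 * s + 39 * r + 12 * k.val + 6) := by
    intro v hv
    rw [Finset.mem_inter, I.mB] at hv
    rw [mem_ivl]
    omega
  exact (Finset.card_le_card this).trans ((card_ivl_le _ _ _).trans (by omega))

lemma card_Z (I : Inst r s S A) (h) (X : Finset (Fin (17 * s + 27 * r))) :
    (X ∩ A (gZ h)).card ≤ 2 := by
  have : X ∩ A (gZ h) ⊆ ivl _ (zpos h) (zpos h + 2) := by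
    intro v hv
    rw [Finset.mem_inter, I.mZ] at hv
    rw [mem_ivl]
    omega
  exact (Finset.card_le_card this).trans ((card_ivl_le _ _ _).trans (by omega))

/-- Any allocation giving every agent at least the values of the constructed allocation gives
exactly these values. -/
lemma upper (I : Inst r s S A) (hiv : ∀ i, Iv (π i)) (hd : ∀ i j, i ≠ j → Disjoint (π i) (π j))
    (hge : ∀ i, len i ≤ (π i ∩ A i).card) : ∀ i, (π i ∩ A i).card ≤ len i := by
  have hrs := I.hrs
  have pairmem : ∀ i p, p + 2 ≤ 17 * s + 27 * r → (∀ v, v ∈ A i ↔ v.val = p ∨ v.val = p + 1) →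
      2 ≤ (π i ∩ A i).card → ∀ v : Fin (17 * s + 27 * r), v.val = p ∨ v.val = p + 1 → v ∈ π i := by
    intro i p hp hA h2 v hv
    have hAe : A i = ivl _ p (p + 2) := by
      ext v; rw [hA, mem_ivl]; omega
    have h1 : π i ∩ A i = A i := by
      apply Finset.eq_of_subset_of_card_le Finset.inter_subset_right
      rw [hAe, card_ivl hp, ← hAe]
      omega
    have : v ∈ π i ∩ A i := by
      rw [h1, hA]; exact hv
    exact (Finset.mem_inter.1 this).1
  have P : SepA π := ⟨hrs, hiv, hd,
    fun h => pairmem (gZ h) (zpos h) (zpos_lt hrs h) (I.mZ h) (hge (gZ h)),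
    fun k => pairmem (gB k) _ (by have := k.2; omega) (I.mB k) (hge (gB k))⟩
  have fK : ∀ k t, (π (gK k t) ∩ A (gK k t)).card =
      (π (gK k t) ∩ ivl _ (5 * s + 39 * r + 12 * k.val) (5 * s + 39 * r + 12 * k.val + 4)).card +
      (π (gK k t) ∩ ivl _ (5 * s + 39 * r + 12 * k.val + 6)
        (5 * s + 39 * r + 12 * k.val + 10)).card := by
    intro k t
    apply card_two (by omega)
    intro w _
    rw [I.mK]
  have hAX : ∀ x t, A (gX x t) = ivl _ (5 * s + 13 * x.val) (5 * s + 13 * x.val + 11) := by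
    intro x t
    ext v
    rw [I.mX, mem_ivl]
  have hgX0 : ∀ x, 5 ≤ (π (gX x 0) ∩ A (gX x 0)).card := fun x => hge (gX x 0)
  have hgX1 : ∀ x, 6 ≤ (π (gX x 1) ∩ A (gX x 1)).card := fun x => hge (gX x 1)
  refine agent_cases ?_ ?_ ?_ ?_ ?_ ?_
  · intro x
    change (π (gI x) ∩ A (gI x)).card ≤ 1
    have hx := x.2
    by_cases hem : (π (gI x) ∩ A (gI x)).card = 0
    · omega
    obtain ⟨v, hv⟩ := Finset.card_pos.1 (Nat.pos_of_ne_zero hem)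
    rw [Finset.mem_inter] at hv
    rcases (I.mI x v).1 hv.2 with ⟨k, j, h1, h2⟩ | h1
    · apply blockone I x k
      intro w hw _
      exact P.blockS (by simp) k hw hv.1 (by omega)
    · exfalso
      have h3 := cnt3 (I := ivl _ (5 * s + 13 * x.val) (5 * s + 13 * x.val + 11))
        (hd (gX x 0) (gX x 1) (by simp)) (hd (gX x 0) (gI x) (by simp))
        (hd (gX x 1) (gI x) (by simp))
      have h4 : 0 < (π (gI x) ∩ ivl _ (5 * s + 13 * x.val) (5 * s + 13 * x.val + 11)).card := by
        refine Finset.card_pos.2 ⟨v, ?_⟩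
        rw [Finset.mem_inter, mem_ivl]
        exact ⟨hv.1, by omega⟩
      have h5 := hgX0 x
      have h6 := hgX1 x
      rw [hAX] at h5 h6
      have h7 := card_ivl_le (17 * s + 27 * r) (5 * s + 13 * x.val) (5 * s + 13 * x.val + 11)
      omega
  · intro k
    change (π (gD k) ∩ A (gD k)).card ≤ 3
    have hk := k.2
    by_cases hem : (π (gD k) ∩ A (gD k)).card = 0
    · omega
    obtain ⟨v, hv⟩ := Finset.card_pos.1 (Nat.pos_of_ne_zero hem)
    rw [Finset.mem_inter] at hv
    rcases (I.mD k v).1 hv.2 with ⟨k', h1⟩ | h1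
    · have : π (gD k) ∩ A (gD k) ⊆ ivl _ (5 * k'.val) (5 * k'.val + 3) := by
        intro w hw
        rw [Finset.mem_inter] at hw
        rw [mem_ivl]
        exact P.blockS (by simp) k' hw.1 hv.1 h1
      exact (Finset.card_le_card this).trans ((card_ivl_le _ _ _).trans (by omega))
    · exfalso
      have c : ∀ a, _ := fun a => cnt3 (I := ivl _ a (a + 4))
        (hd (gK k 0) (gK k 1) (by simp)) (hd (gK k 0) (gD k) (by simp))
        (hd (gK k 1) (gD k) (by simp))
      have c1 := c (5 * s + 39 * r + 12 * k.val)
      have c2 := c (5 * s + 39 * r + 12 * k.val + 6)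
      have d1 := card_ivl_le (17 * s + 27 * r) (5 * s + 39 * r + 12 * k.val)
        (5 * s + 39 * r + 12 * k.val + 4)
      have d2 := card_ivl_le (17 * s + 27 * r) (5 * s + 39 * r + 12 * k.val + 6)
        (5 * s + 39 * r + 12 * k.val + 6 + 4)
      have a0 : 4 ≤ _ := hge (gK k 0)
      have a1 : 4 ≤ _ := hge (gK k 1)
      rw [fK] at a0 a1
      have h4 : 0 < (π (gD k) ∩ ivl _ (5 * s + 39 * r + 12 * k.val)
            (5 * s + 39 * r + 12 * k.val + 4)).card ∨
          0 < (π (gD k) ∩ ivl _ (5 * s + 39 * r + 12 * k.val + 6)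
            (5 * s + 39 * r + 12 * k.val + 6 + 4)).card := by
        rcases h1 with h1 | h1
        · left
          refine Finset.card_pos.2 ⟨v, ?_⟩
          rw [Finset.mem_inter, mem_ivl]
          exact ⟨hv.1, h1⟩
        · right
          refine Finset.card_pos.2 ⟨v, ?_⟩
          rw [Finset.mem_inter, mem_ivl]
          exact ⟨hv.1, h1⟩
      simp only [Nat.add_assoc, Nat.reduceAdd] at *
      omega
  · intro x t
    have h3 := cnt2 (I := ivl _ (5 * s + 13 * x.val) (5 * s + 13 * x.val + 11))
      (hd (gX x 0) (gX x 1) (by simp))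
    have h5 := hgX0 x
    have h6 := hgX1 x
    have h7 := card_ivl_le (17 * s + 27 * r) (5 * s + 13 * x.val) (5 * s + 13 * x.val + 11)
    rw [hAX] at h5 h6 ⊢
    fin_cases t
    · change (π (gX x 0) ∩ _).card ≤ 5
      omega
    · change (π (gX x 1) ∩ _).card ≤ 6
      omega
  · intro k t
    change (π (gK k t) ∩ A (gK k t)).card ≤ 4
    rw [fK]
    have h1 := P.zero_or (j := gK k t) (i := gB k) (by simp)
      (p := 5 * s + 39 * r + 12 * k.val + 4)
      (a := 5 * s + 39 * r + 12 * k.val) (b := 5 * s + 39 * r + 12 * k.val + 4)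
      (c := 5 * s + 39 * r + 12 * k.val + 6) (d := 5 * s + 39 * r + 12 * k.val + 10)
      (fun v hv => P.b k v (Or.inl hv)) le_rfl (by omega)
    have d1 := (Finset.card_le_card (Finset.inter_subset_right (s₁ := π (gK k t)))).trans
      (card_ivl_le (17 * s + 27 * r) (5 * s + 39 * r + 12 * k.val)
        (5 * s + 39 * r + 12 * k.val + 4))
    have d2 := (Finset.card_le_card (Finset.inter_subset_right (s₁ := π (gK k t)))).trans
      (card_ivl_le (17 * s + 27 * r) (5 * s + 39 * r + 12 * k.val + 6)
        (5 * s + 39 * r + 12 * k.val + 10))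
    omega
  · intro k
    exact card_B I k _
  · intro h
    exact card_Z I h _

/-- Encoding of an exact cover. -/
structure Cover (S : Fin s → Fin 3 → Fin (3 * r)) (kx : Fin (3 * r) → Fin s)
    (jx : Fin (3 * r) → Fin 3) (e : Fin (s - r) → Fin s) : Prop where
  hS : ∀ x, S (kx x) (jx x) = x
  hne : ∀ x k, (kx x).val ≠ (e k).val
  hinj : ∀ k k' : Fin (s - r), k.val ≠ k'.val → (e k).val ≠ (e k').val
  hcov : ∀ k j, (∃ k', e k' = k) ∨ (kx (S k j) = k ∧ jx (S k j) = j)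

lemma cover_of (hrs : r ≤ s) (S' : Finset (Fin s)) (hc : S'.card = r)
    (h : ∀ x : Fin (3 * r), ∃ k ∈ S', ∃ j, S k j = x) : ∃ kx jx e, Cover S kx jx e := by
  classical
  choose kx hk jx hj using h
  have hcc : (S'ᶜ).card = s - r := by
    rw [Finset.card_compl, hc, Fintype.card_fin]
  let E := (S'ᶜ).equivFinOfCardEq hcc
  have hEm : ∀ k, (E.symm k).1 ∉ S' := fun k => Finset.mem_compl.1 (E.symm k).2
  refine ⟨kx, jx, fun k => (E.symm k).1, hj, ?_, ?_, ?_⟩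
  · intro x k heq
    apply hEm k
    rw [← Fin.ext heq]
    exact hk x
  · intro k k' hne heq
    apply hne
    have := E.symm.injective (Subtype.ext (Fin.ext heq))
    rw [this]
  · intro k j
    by_cases hkS : k ∈ S'
    · right
      have hFinj : Function.Injective (fun x => (kx x, jx x)) := by
        intro x y hxy
        simp only [Prod.mk.injEq] at hxy
        rw [← hj x, ← hj y, hxy.1, hxy.2]
      have himg : (Finset.univ.image (fun x => (kx x, jx x))) = S' ×ˢ (Finset.univ : Finset (Fin 3)) := by
        apply Finset.eq_of_subset_of_card_le
        · intro p hp
          rw [Finset.mem_image] at hp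
          obtain ⟨x, _, rfl⟩ := hp
          simp [hk x]
        · rw [Finset.card_image_of_injective _ hFinj, Finset.card_product, hc]
          simp
          omega
      have hmem : (k, j) ∈ Finset.univ.image (fun x => (kx x, jx x)) := by
        rw [himg]; simp [hkS]
      rw [Finset.mem_image] at hmem
      obtain ⟨x, _, hx⟩ := hmem
      simp only [Prod.mk.injEq] at hx
      have : S k j = x := by rw [← hx.1, ← hx.2, hj x]
      rw [this]
      exact hx
    · left
      exact ⟨E ⟨k, Finset.mem_compl.2 hkS⟩, by simp⟩


section Backward

variable {kx : Fin (3 * r) → Fin s} {jx : Fin (3 * r) → Fin 3} {e : Fin (s - r) → Fin s}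

/-- The bundle of an agent in the allocation built from an exact cover. -/
def bundle (kx : Fin (3 * r) → Fin s) (jx : Fin (3 * r) → Fin 3) (e : Fin (s - r) → Fin s)
    (i : X3CEF1Agents r s) : Finset (Fin (17 * s + 27 * r)) :=
  ivl _ (lo kx jx e i) (lo kx jx e i + len i)

lemma bundle_bound (hrs : r ≤ s) (i : X3CEF1Agents r s) :
    lo kx jx e i + len i ≤ 17 * s + 27 * r := by
  rcases i with x | x | ⟨x, t⟩ | ⟨x, t⟩ | x | h
  · have := (kx x).2
    have := (jx x).2
    simp only [lo, len]; omega
  · have := (e x).2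
    simp only [lo, len]; omega
  · have := x.2
    have := t.2
    simp only [lo, len]; omega
  · have := x.2
    have := t.2
    simp only [lo, len]; omega
  · have := x.2
    simp only [lo, len]; omega
  · exact zpos_lt hrs h

lemma bundle_sub (I : Inst r s S A) (C : Cover S kx jx e) (i : X3CEF1Agents r s) :
    bundle kx jx e i ⊆ A i := by
  intro v hv
  rw [bundle, mem_ivl] at hv
  rcases i with x | x | ⟨x, t⟩ | ⟨x, t⟩ | x | h
  · simp only [lo, len] at hv
    rw [I.mI]
    exact Or.inl ⟨kx x, jx x, by omega, C.hS x⟩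
  · simp only [lo, len] at hv
    rw [I.mD]
    exact Or.inl ⟨e x, hv⟩
  · have := t.2
    simp only [lo, len] at hv
    rw [I.mX]
    omega
  · have := t.2
    simp only [lo, len] at hv
    rw [I.mK]
    omega
  · simp only [lo, len] at hv
    rw [I.mB]
    omega
  · simp only [lo, len] at hv
    rw [I.mZ]
    omega

lemma bundle_val (I : Inst r s S A) (C : Cover S kx jx e) (i : X3CEF1Agents r s) :
    (bundle kx jx e i ∩ A i).card = len i := by
  rw [Finset.inter_eq_left.2 (bundle_sub I C i), bundle, card_ivl (bundle_bound I.hrs i)]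
  omega

lemma bundle_sep (hrs : r ≤ s) (C : Cover S kx jx e) (i j : X3CEF1Agents r s) (hne : i ≠ j) :
    lo kx jx e i + len i ≤ lo kx jx e j ∨ lo kx jx e j + len j ≤ lo kx jx e i := by
  have hII : ∀ x y, x.val ≠ y.val → (kx x).val ≠ (kx y).val ∨ (jx x).val ≠ (jx y).val := by
    intro x y hxy
    by_contra hc
    push Not at hc
    apply hxy
    rw [← C.hS x, ← C.hS y, Fin.ext hc.1, Fin.ext hc.2]
  have hl : ∀ x, (kx x).val < s ∧ (jx x).val < 3 := fun x => ⟨(kx x).2, (jx x).2⟩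
  have he : ∀ x, (e x).val < s := fun x => (e x).2
  have hf : ∀ t : Fin 2, t.val = 0 ∨ t.val = 1 := fun t => by omega
  have h1 := C.hne
  have h2 := C.hinj
  clear C
  revert hne
  rcases i with x | x | ⟨x, t⟩ | ⟨x, t⟩ | x | (x | x | x) <;>
  rcases j with y | y | ⟨y, t'⟩ | ⟨y, t'⟩ | y | (y | y | y) <;>
  intro hne <;>
  have := x.2 <;> have := y.2 <;>
  (try have := hII x y) <;> (try have := h1 x y) <;> (try have := h1 y x) <;>
  (try have := h2 x y) <;> (try have := hl x) <;> (try have := hl y) <;>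
  (try have := he x) <;> (try have := he y) <;> (try have := hf t) <;> (try have := hf t') <;>
  clear hf hII h1 h2 hl he <;>
  simp only [lo, len, zpos, ne_eq, Sum.inl.injEq, Sum.inr.injEq, Prod.mk.injEq,
    Fin.ext_iff] at * <;>
  omega

lemma bundle_cov (hrs : r ≤ s) (C : Cover S kx jx e) (v : Fin (17 * s + 27 * r)) :
    ∃ i, v ∈ bundle kx jx e i := by
  have hv := v.2
  simp only [bundle, mem_ivl]
  by_cases h1 : v.val < 5 * s
  · let k : Fin s := ⟨v.val / 5, by omega⟩
    by_cases hj : v.val % 5 < 3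
    · let j : Fin 3 := ⟨v.val % 5, hj⟩
      rcases C.hcov k j with ⟨k', hk⟩ | ⟨hk, hj'⟩
      · refine ⟨gD k', ?_⟩
        simp only [lo, len, hk, k]
        omega
      · refine ⟨gI (S k j), ?_⟩
        simp only [lo, len, hk, hj']
        simp only [k, j]
        omega
    · refine ⟨gZ (.inl k), ?_⟩
      simp only [lo, len, zpos, k]
      omega
  by_cases h2 : v.val < 5 * s + 39 * r
  · let x : Fin (3 * r) := ⟨(v.val - 5 * s) / 13, by omega⟩
    by_cases h3 : (v.val - 5 * s) % 13 < 5
    · refine ⟨gX x 0, ?_⟩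
      simp only [lo, len, x, Fin.val_zero]
      omega
    by_cases h4 : (v.val - 5 * s) % 13 < 11
    · refine ⟨gX x 1, ?_⟩
      simp only [lo, len, x, Fin.val_one]
      omega
    refine ⟨gZ (.inr (.inl x)), ?_⟩
    simp only [lo, len, zpos, x]
    omega
  · let x : Fin (s - r) := ⟨(v.val - 5 * s - 39 * r) / 12, by omega⟩
    by_cases h3 : (v.val - 5 * s - 39 * r) % 12 < 4
    · refine ⟨gK x 0, ?_⟩
      simp only [lo, len, x, Fin.val_zero]
      omega
    by_cases h4 : (v.val - 5 * s - 39 * r) % 12 < 6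
    · refine ⟨gB x, ?_⟩
      simp only [lo, len, x]
      omega
    by_cases h5 : (v.val - 5 * s - 39 * r) % 12 < 10
    · refine ⟨gK x 1, ?_⟩
      simp only [lo, len, x, Fin.val_one]
      omega
    refine ⟨gZ (.inr (.inr x)), ?_⟩
    simp only [lo, len, zpos, x]
    omega

lemma bundle_ef (I : Inst r s S A) (i j : X3CEF1Agents r s) :
    (bundle kx jx e j ∩ A i).card ≤ len i ∨
    ∃ v ∈ bundle kx jx e j, Iv ((bundle kx jx e j).erase v) ∧
      ((bundle kx jx e j).erase v ∩ A i).card ≤ len i := by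
  have hrs := I.hrs
  have hb := bundle_bound (kx := kx) (jx := jx) (e := e) hrs j
  have hc : (bundle kx jx e j).card ≤ len j := by
    refine (card_ivl_le _ _ _).trans ?_
    omega
  have small : len j ≤ len i → (bundle kx jx e j ∩ A i).card ≤ len i := fun h =>
    (Finset.card_le_card Finset.inter_subset_left).trans (hc.trans h)
  have one : len j = len i + 1 → ∃ v ∈ bundle kx jx e j, Iv ((bundle kx jx e j).erase v) ∧
      ((bundle kx jx e j).erase v ∩ A i).card ≤ len i := by
    intro h
    refine ⟨⟨lo kx jx e j, by omega⟩, ?_, ?_, ?_⟩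
    · rw [bundle, mem_ivl]
      simp only
      omega
    · have : (bundle kx jx e j).erase ⟨lo kx jx e j, by omega⟩ =
          ivl _ (lo kx jx e j + 1) (lo kx jx e j + len j) := by
        ext v
        rw [Finset.mem_erase, bundle, mem_ivl, mem_ivl, ne_eq, Fin.ext_iff]
        simp only
        omega
      rw [this]
      exact iv_ivl _ _ _
    · refine (Finset.card_le_card Finset.inter_subset_left).trans ?_
      rw [Finset.card_erase_of_mem]
      · omega
      · rw [bundle, mem_ivl]
        simp only
        omega
  have emp : (∀ v ∈ bundle kx jx e j, v ∉ A i) → (bundle kx jx e j ∩ A i).card ≤ len i := by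
    intro h
    have : bundle kx jx e j ∩ A i = ∅ := by
      rw [← Finset.disjoint_iff_inter_eq_empty, Finset.disjoint_left]
      exact fun v hv => h v hv
    rw [this]
    simp
  rcases i with x | k | ⟨x, t⟩ | ⟨k, t⟩ | k | h
  · rcases j with x' | k' | ⟨x', t'⟩ | ⟨k', t'⟩ | k' | h'
    · exact Or.inl (small le_rfl)
    · left
      apply blockone I x (e k')
      intro v hv _
      rw [bundle, mem_ivl] at hv
      exact hv
    · have hx := x.2
      have hx' := x'.2
      have ht := t'.2
      by_cases hcase : x' = x ∧ t'.val = 0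
      · obtain ⟨rfl, ht0⟩ := hcase
        simp only [bundle, lo, len] at hb ⊢
        right
        have hp : 5 * s + 13 * x'.val + 4 < 17 * s + 27 * r := by omega
        have : (ivl (17 * s + 27 * r) (5 * s + 13 * x'.val + 5 * t'.val)
            (5 * s + 13 * x'.val + 5 * t'.val + (5 + t'.val))).erase
            ⟨5 * s + 13 * x'.val + 4, hp⟩ =
          ivl _ (5 * s + 13 * x'.val) (5 * s + 13 * x'.val + 4) := by
          ext v
          rw [Finset.mem_erase, mem_ivl, mem_ivl, ne_eq, Fin.ext_iff]
          simp only
          omega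
        refine ⟨⟨5 * s + 13 * x'.val + 4, hp⟩, ?_, ?_, ?_⟩
        · rw [mem_ivl]
          simp only
          omega
        · rw [this]
          exact iv_ivl _ _ _
        · rw [this]
          have hsub : ivl _ (5 * s + 13 * x'.val) (5 * s + 13 * x'.val + 4) ∩ A (gI x') ⊆
              ivl _ (5 * s + 13 * x'.val + 3) (5 * s + 13 * x'.val + 4) := by
            intro v hv
            rw [Finset.mem_inter, mem_ivl, I.mI] at hv
            rw [mem_ivl]
            obtain ⟨hv1, ⟨k, j, h1, _⟩ | h1⟩ := hv
            · have := k.2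
              have := j.2
              omega
            · omega
          exact (Finset.card_le_card hsub).trans ((card_ivl_le _ _ _).trans (by omega))
      · left
        apply emp
        intro v hv hA
        rw [bundle, mem_ivl] at hv
        simp only [lo, len] at hv
        rw [Fin.ext_iff] at hcase
        rcases (I.mI x v).1 hA with ⟨k, j, h1, _⟩ | h1
        · have := k.2
          have := j.2
          omega
        · omega
    · left
      apply emp
      intro v hv hA
      rw [bundle, mem_ivl] at hv
      simp only [lo, len] at hv
      have hx := x.2
      rcases (I.mI x v).1 hA with ⟨k, j, h1, _⟩ | h1
      · have := k.2
        have := j.2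
        omega
      · omega
    · exact Or.inr (one rfl)
    · exact Or.inr (one rfl)
  · rcases j with x' | k' | ⟨x', t'⟩ | ⟨k', t'⟩ | k' | h'
    · exact Or.inl (small (by simp [len]))
    · exact Or.inl (small le_rfl)
    · left
      apply emp
      intro v hv hA
      rw [bundle, mem_ivl] at hv
      simp only [lo, len] at hv
      have hx := x'.2
      have ht := t'.2
      rcases (I.mD k v).1 hA with ⟨k, h1⟩ | h1
      · have := k.2
        omega
      · omega
    · exact Or.inr (one rfl)
    · exact Or.inl (small (by simp [len]))
    · exact Or.inl (small (by simp [len]))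
  · by_cases hl : len j ≤ 5 + t.val
    · exact Or.inl (small hl)
    · right
      apply one
      rcases j with x' | k' | ⟨x', t'⟩ | ⟨k', t'⟩ | k' | h' <;> simp only [len] at hl ⊢ <;> omega
  · rcases j with x' | k' | ⟨x', t'⟩ | ⟨k', t'⟩ | k' | h'
    · exact Or.inl (small (by simp [len]))
    · exact Or.inl (small (by simp [len]))
    · left
      apply emp
      intro v hv hA
      rw [bundle, mem_ivl] at hv
      simp only [lo, len] at hv
      have hx := x'.2
      have ht := t'.2
      have := (I.mK k t v).1 hA
      omega
    · exact Or.inl (small le_rfl)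
    · exact Or.inl (small (by simp [len]))
    · exact Or.inl (small (by simp [len]))
  · exact Or.inl (card_B I k _)
  · exact Or.inl (card_Z I h _)

lemma backward (I : Inst r s S A) (C : Cover S kx jx e)
    {u : X3CEF1Agents r s → Finset (Fin (17 * s + 27 * r)) → ℝ}
    (hu : ∀ i X, u i X = ((X ∩ A i).card : ℝ)) :
    ∃ π : X3CEF1Agents r s → Finset (Fin (17 * s + 27 * r)),
      IsConnAlloc (SimpleGraph.pathGraph (17 * s + 27 * r)) π ∧
      ParetoOptimal (SimpleGraph.pathGraph (17 * s + 27 * r)) u π ∧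
      EF1 (SimpleGraph.pathGraph (17 * s + 27 * r)) u π := by
  refine ⟨bundle kx jx e, ⟨fun i => Finset.subset_univ _, fun i => iv_imp_conn (iv_ivl _ _ _),
    ?_, fun v _ => bundle_cov I.hrs C v⟩, ?_, ?_⟩
  · intro i j hne
    rw [Finset.disjoint_left]
    intro v hv hv'
    rw [bundle, mem_ivl] at hv hv'
    have := bundle_sep I.hrs C i j hne
    omega
  · rintro π' hπ ⟨h1, i, h2⟩
    have hge : ∀ i, len i ≤ (π' i ∩ A i).card := by
      intro i
      have := h1 i
      rw [hu, hu, bundle_val I C] at this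
      exact_mod_cast this
    have hle := upper I (fun i => conn_imp_iv (hπ.2.1 i)) hπ.2.2.1 hge i
    rw [hu, hu, bundle_val I C] at h2
    have h3 : len i < (π' i ∩ A i).card := by exact_mod_cast h2
    omega
  · intro i j
    rcases bundle_ef (kx := kx) (jx := jx) (e := e) I i j with h | ⟨v, hv, h1, h2⟩
    · left
      rw [hu, hu, bundle_val I C]
      exact_mod_cast h
    · right
      refine ⟨v, hv, iv_imp_conn h1, ?_⟩
      rw [hu, hu, bundle_val I C]
      exact_mod_cast h2

end Backward

end Instance

/-- the X3C path instance for PO & EF1. The path has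
`17s + 27r` vertices (encoded as `Fin (17*s + 27*r)`), obtained by
concatenating, in order, `P_{S_1}, P_{z_1}, …, P_{S_s}, P_{z_s}`, then
`P_{x_1}, P_{z_{s+1}}, …, P_{x_{3r}}, P_{z_{s+3r}}`, then
`P_{d_1}, P_{z_{s+3r+1}}, …, P_{d_{s−r}}, P_{z_{2s+2r}}`; the positions of the
vertices of `P_{S_k}`, `P_{x}`, `P_{d_k}` and `P_{z_h}` are `vS k j`, `vx x j`,
`vd k j` and `vz h t` respectively. The agents' binary additive valuations are
given by the approval sets `A`. Then a Pareto-optimal EF1 connected allocation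
exists iff the X3C instance has an exact cover. -/
theorem stmt10 (r s : ℕ) (hrs : r ≤ s)
    (S : Fin s → Fin 3 → Fin (3 * r)) (hS : ∀ k, Function.Injective (S k))
    (vS : Fin s → Fin 3 → Fin (17 * s + 27 * r))
    (hvS : ∀ k j, (vS k j : ℕ) = 5 * (k : ℕ) + (j : ℕ))
    (vx : Fin (3 * r) → Fin 11 → Fin (17 * s + 27 * r))
    (hvx : ∀ x j, (vx x j : ℕ) = 5 * s + 13 * (x : ℕ) + (j : ℕ))
    (vd : Fin (s - r) → Fin 10 → Fin (17 * s + 27 * r))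
    (hvd : ∀ k j, (vd k j : ℕ) = 5 * s + 39 * r + 12 * (k : ℕ) + (j : ℕ))
    (vz : (Fin s ⊕ Fin (3 * r) ⊕ Fin (s - r)) → Fin 2 → Fin (17 * s + 27 * r))
    (hvz1 : ∀ k t, (vz (Sum.inl k) t : ℕ) = 5 * (k : ℕ) + 3 + (t : ℕ))
    (hvz2 : ∀ x t, (vz (Sum.inr (Sum.inl x)) t : ℕ) =
      5 * s + 13 * (x : ℕ) + 11 + (t : ℕ))
    (hvz3 : ∀ k t, (vz (Sum.inr (Sum.inr k)) t : ℕ) =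
      5 * s + 39 * r + 12 * (k : ℕ) + 10 + (t : ℕ))
    (A : X3CEF1Agents r s → Finset (Fin (17 * s + 27 * r)))
    (hAi : ∀ x, A (Sum.inl x) = Finset.univ.filter (fun v =>
      (∃ k j, v = vS k j ∧ S k j = x) ∨ v = vx x 3 ∨ v = vx x 4))
    (hAd : ∀ k, A (Sum.inr (Sum.inl k)) = Finset.univ.filter (fun v =>
      (∃ k' j, v = vS k' j) ∨
      (∃ j : Fin 10, (j : ℕ) ≠ 4 ∧ (j : ℕ) ≠ 5 ∧ v = vd k j)))
    (hAax : ∀ x t, A (Sum.inr (Sum.inr (Sum.inl (x, t)))) =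
      Finset.univ.filter (fun v => ∃ j, v = vx x j))
    (hAak : ∀ k t, A (Sum.inr (Sum.inr (Sum.inr (Sum.inl (k, t))))) =
      Finset.univ.filter (fun v =>
        ∃ j : Fin 10, (j : ℕ) ≠ 4 ∧ (j : ℕ) ≠ 5 ∧ v = vd k j))
    (hAb : ∀ k, A (Sum.inr (Sum.inr (Sum.inr (Sum.inr (Sum.inl k))))) =
      {vd k 4, vd k 5})
    (hAz : ∀ h, A (Sum.inr (Sum.inr (Sum.inr (Sum.inr (Sum.inr h))))) =
      {vz h 0, vz h 1})
    (u : X3CEF1Agents r s → Finset (Fin (17 * s + 27 * r)) → ℝ)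
    (hu : ∀ i X, u i X = ((X ∩ A i).card : ℝ)) :
    (∃ π : X3CEF1Agents r s → Finset (Fin (17 * s + 27 * r)),
      IsConnAlloc (SimpleGraph.pathGraph (17 * s + 27 * r)) π ∧
      ParetoOptimal (SimpleGraph.pathGraph (17 * s + 27 * r)) u π ∧
      EF1 (SimpleGraph.pathGraph (17 * s + 27 * r)) u π) ↔
    (∃ S' : Finset (Fin s), S'.card = r ∧
      ∀ x : Fin (3 * r), ∃ k ∈ S', ∃ j, S k j = x) := by
  have I : Inst r s S A := by
    refine ⟨hrs, hS, ?_, ?_, ?_, ?_, ?_, ?_⟩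
    · intro x v
      simp only [gI, hAi, Finset.mem_filter, Finset.mem_univ, true_and, Fin.ext_iff, hvS, hvx]
      rfl
    · intro k v
      simp only [gD, hAd, Finset.mem_filter, Finset.mem_univ, true_and, Fin.ext_iff, hvS, hvd]
      constructor
      · rintro (⟨k', j, h⟩ | ⟨j, h1, h2, h⟩)
        · exact Or.inl ⟨k', by omega, by omega⟩
        · right
          omega
      · rintro (⟨k', h1, h2⟩ | h)
        · exact Or.inl ⟨k', ⟨v.val - 5 * k'.val, by omega⟩, by simp only; omega⟩
        · right
          refine ⟨⟨v.val - (5 * s + 39 * r + 12 * k.val), by omega⟩, ?_, ?_, ?_⟩ <;>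
            simp only <;> omega
    · intro x t v
      simp only [gX, hAax, Finset.mem_filter, Finset.mem_univ, true_and, Fin.ext_iff, hvx]
      constructor
      · rintro ⟨j, h⟩
        omega
      · intro h
        exact ⟨⟨v.val - (5 * s + 13 * x.val), by omega⟩, by simp only; omega⟩
    · intro k t v
      simp only [gK, hAak, Finset.mem_filter, Finset.mem_univ, true_and, Fin.ext_iff, hvd]
      constructor
      · rintro ⟨j, h1, h2, h⟩
        omega
      · intro h
        refine ⟨⟨v.val - (5 * s + 39 * r + 12 * k.val), by omega⟩, ?_, ?_, ?_⟩ <;>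
          simp only <;> omega
    · intro k v
      simp only [gB, hAb, Finset.mem_insert, Finset.mem_singleton, Fin.ext_iff, hvd]
      rfl
    · intro h v
      simp only [gZ, hAz, Finset.mem_insert, Finset.mem_singleton, Fin.ext_iff]
      rcases h with k | x | k
      · rw [hvz1, hvz1]; rfl
      · rw [hvz2, hvz2]; rfl
      · rw [hvz3, hvz3]; rfl
  constructor
  · rintro ⟨π, h1, h2, h3⟩
    exact forward I (good_of hu h1 h2 h3)
  · rintro ⟨S', hc, h⟩
    obtain ⟨kx, jx, e, C⟩ := cover_of hrs S' hc h
    exact backward I C hu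
end
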